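/- arXiv:1508.02335 — 2 statements merged into one kernel-verified Lean document; each statement's English description precedes it below -/
import Mathlib

section
/- Let (X, 𝓑, T) be a Borel system admitting no T-invariant Borel probability measure. Then T admits a two-set generator: there exists a Borel set A ∈ 𝓑 such that the σ-algebra generated by the family {T^n A : n ∈ ℤ} equals 𝓑. -/
namespace TwoSetGenerator

open MeasureTheory Set Function Filter Topology
open scoped ENNReal BoundedContinuousFunction

/-- The subgraph of `u`, seen as a family of `u x` cells over each point `x`. -/
def cells {X : Type*} (u : X → ℕ) : Set (X × ℕ) := {p | p.2 < u p.1}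

/-- `T` is an automorphism of the measurable space `m`. -/
def IsAuto {X : Type*} (T : Equiv.Perm X) (m : MeasurableSpace X) : Prop :=
  Measurable[m, m] T ∧ Measurable[m, m] T.symm

section Measurability

variable {X : Type*} {m : MeasurableSpace X} {T : Equiv.Perm X}

theorem IsAuto.iterate (h : IsAuto T m) (n : ℕ) : Measurable (T^[n]) := h.1.iterate n

theorem IsAuto.zpow (h : IsAuto T m) (n : ℤ) : Measurable (T ^ n) := by
  have key : ∀ k : ℕ, Measurable (T ^ k) ∧ Measurable ⇑((T ^ k)⁻¹) := by
    intro k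
    induction k with
    | zero => exact ⟨measurable_id, measurable_id⟩
    | succ k ih =>
      refine ⟨?_, ?_⟩
      · rw [pow_succ]; exact ih.1.comp h.1
      · rw [pow_succ, mul_inv_rev]; exact h.2.comp ih.2
  obtain ⟨k, rfl | rfl⟩ := n.eq_nat_or_neg
  · simpa using (key k).1
  · simpa using (key k).2

theorem measurable_sInf_nat {p : X → ℕ → Prop} (hp : ∀ n, MeasurableSet {x | p x n}) :
    Measurable fun x => sInf {n | p x n} := by
  classical
  have hE : MeasurableSet {x | ∃ n, p x n} := by
    have : {x | ∃ n, p x n} = ⋃ n, {x | p x n} := by ext; simp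
    rw [this]; exact MeasurableSet.iUnion hp
  have h1 : Measurable fun x => Nat.find (p := fun n => p x n ∨ ¬ ∃ n, p x n)
      (by by_cases h : ∃ n, p x n
          · obtain ⟨n, hn⟩ := h; exact ⟨n, Or.inl hn⟩
          · exact ⟨0, Or.inr h⟩) := by
    apply measurable_find
    intro k
    exact (hp k).union hE.compl
  convert h1 using 2 with x
  by_cases h : ∃ n, p x n
  · have hmem : p x (sInf {n | p x n}) := Nat.sInf_mem (s := {n | p x n}) h
    refine (Nat.find_eq_iff _).2 ⟨Or.inl hmem, fun n hn hpn => ?_⟩ |>.symm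
    exact Nat.notMem_of_lt_sInf hn (hpn.resolve_right (not_not.2 h))
  · have : {n | p x n} = ∅ := by ext n; simpa using fun hn => h ⟨n, hn⟩
    rw [this, Nat.sInf_empty, eq_comm, Nat.find_eq_zero]
    exact Or.inr h

theorem measurable_birkhoffSum {R : Type*} [AddCommMonoid R] [MeasurableSpace R]
    [MeasurableAdd₂ R] {f : X → X} (hf : Measurable f) {u : X → R} (hu : Measurable u) (n : ℕ) : Measurable (birkhoffSum f u n) := by
  unfold birkhoffSum
  exact Finset.measurable_sum _ fun k _ => hu.comp (hf.iterate k)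

theorem measurable_iterate_apply {Z : Type*} [MeasurableSpace Z] {f : X → X} (hf : Measurable f)
    {n : Z → ℕ} (hn : Measurable n) {g : Z → X} (hg : Measurable g) :
    Measurable fun z => f^[n z] (g z) := by
  have : Measurable fun q : ℕ × X => f^[q.1] q.2 :=
    measurable_from_prod_countable_right fun n => hf.iterate n
  exact this.comp (hn.prodMk hg)

end Measurability

section Matching

variable {X : Type*}

/-- The first time at which the demand unit `p` over the point `p.1` is served when later
demands are served first. -/
noncomputable def serveTime (f : X → X) (u v : X → ℕ) (p : X × ℕ) : ℕ :=
  sInf {n | birkhoffSum f u n (f p.1) + p.2 + 1 ≤ birkhoffSum f v (n + 1) p.1}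

/-- The last-in-first-out matching of the demand `u` with the supply `v`. -/
noncomputable def serve (f : X → X) (u v : X → ℕ) (p : X × ℕ) : X × ℕ :=
  (f^[serveTime f u v p] p.1,
    p.2 + birkhoffSum f u (serveTime f u v p) (f p.1) - birkhoffSum f v (serveTime f u v p) p.1)

theorem measurable_serve {m : MeasurableSpace X} {f : X → X} (hf : Measurable f) {u v : X → ℕ}
    (hu : Measurable u) (hv : Measurable v) : Measurable (serve f u v) := by
  have hsum : ∀ (w : X → ℕ), Measurable w → Measurable fun q : ℕ × X => birkhoffSum f w q.1 q.2 :=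
    fun w hw => measurable_from_prod_countable_right fun n => measurable_birkhoffSum hf hw n
  have ht : Measurable (serveTime f u v) := by
    apply measurable_sInf_nat
    intro n
    apply measurableSet_le
    · exact (((measurable_birkhoffSum hf hu n).comp (hf.comp measurable_fst)).add
        measurable_snd).add_const 1
    · exact (measurable_birkhoffSum hf hv (n + 1)).comp measurable_fst
  refine (measurable_iterate_apply hf ht measurable_fst).prodMk ?_
  exact (measurable_snd.add ((hsum u hu).comp (ht.prodMk (hf.comp measurable_fst)))).sub
    ((hsum v hv).comp (ht.prodMk measurable_fst))

theorem serveTime_spec {f : X → X} {u v : X → ℕ}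
    (h : ∀ x, 0 < u x → ∃ N, 0 < N ∧ birkhoffSum f u N x ≤ birkhoffSum f v N x)
    {p : X × ℕ} (hp : p ∈ cells u) :
    birkhoffSum f u (serveTime f u v p) (f p.1) + p.2 + 1
      ≤ birkhoffSum f v (serveTime f u v p + 1) p.1 := by
  have hp' : p.2 < u p.1 := hp
  obtain ⟨N, hN, hle⟩ := h p.1 (by omega)
  obtain ⟨n, rfl⟩ : ∃ n, N = n + 1 := ⟨N - 1, by omega⟩
  have : n ∈ {n | birkhoffSum f u n (f p.1) + p.2 + 1 ≤ birkhoffSum f v (n + 1) p.1} := by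
    rw [birkhoffSum_succ'] at hle
    simp only [mem_ofPred_eq]
    omega
  exact Nat.sInf_mem ⟨n, this⟩

theorem lt_of_lt_serveTime {f : X → X} {u v : X → ℕ} {p : X × ℕ} {n : ℕ}
    (hn : n < serveTime f u v p) :
    birkhoffSum f v (n + 1) p.1 < birkhoffSum f u n (f p.1) + p.2 + 1 := by
  have := Nat.notMem_of_lt_sInf hn
  simpa only [mem_ofPred_eq, not_le] using this

theorem serve_sum_le {f : X → X} {u v : X → ℕ} {p : X × ℕ} :
    birkhoffSum f v (serveTime f u v p) p.1
      ≤ p.2 + birkhoffSum f u (serveTime f u v p) (f p.1) := by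
  rcases hn : serveTime f u v p with _ | n
  · simp
  · have := lt_of_lt_serveTime (f := f) (u := u) (v := v) (p := p) (n := n) (by omega)
    rw [birkhoffSum_succ f u]
    omega

theorem mapsTo_serve {f : X → X} {u v : X → ℕ}
    (h : ∀ x, 0 < u x → ∃ N, 0 < N ∧ birkhoffSum f u N x ≤ birkhoffSum f v N x) :
    MapsTo (serve f u v) (cells u) (cells v) := by
  intro p hp
  have h1 := serveTime_spec h hp
  have h2 := serve_sum_le (f := f) (u := u) (v := v) (p := p)
  rw [birkhoffSum_succ] at h1
  change _ - _ < v _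
  simp only [serve]
  omega

theorem injOn_serve {f : X → X} (hf : Injective f) {u v : X → ℕ} :
    InjOn (serve f u v) (cells u) := by
  have key : ∀ p ∈ cells u, ∀ q ∈ cells u, serve f u v p = serve f u v q →
      serveTime f u v q ≤ serveTime f u v p → p = q := by
    rintro ⟨x, j⟩ hp ⟨y, l⟩ hq h hle
    have hl : l < u y := hq
    have e1 := serve_sum_le (f := f) (u := u) (v := v) (p := (x, j))
    have e2 := serve_sum_le (f := f) (u := u) (v := v) (p := (y, l))
    have hmin : ∀ n < serveTime f u v (x, j), _ := fun n hn => lt_of_lt_serveTime hn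
    simp only [serve, Prod.mk.injEq] at h e1 e2 hmin
    set a := serveTime f u v (x, j)
    set b := serveTime f u v (y, l)
    obtain ⟨d, hd⟩ : ∃ d, a = d + b := ⟨a - b, by omega⟩
    obtain ⟨hxy, hs⟩ := h
    rw [hd, add_comm d b, iterate_add_apply] at hxy
    have hy : f^[d] x = y := hf.iterate b hxy
    rw [hd, birkhoffSum_add f v d b x, birkhoffSum_add f u d b (f x), hy,
      ← iterate_succ_apply, iterate_succ_apply', hy] at hs e1
    rcases d with _ | d
    · simp only [iterate_zero, id] at hy
      subst hy
      simp at hs e1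
      have : j = l := by omega
      rw [this]
    · exfalso
      have h3 := hmin d (by omega)
      rw [birkhoffSum_succ f u d (f x), ← iterate_succ_apply, hy] at hs e1
      omega
  intro p hp q hq h
  rcases le_total (serveTime f u v q) (serveTime f u v p) with hle | hle
  · exact key p hp q hq h hle
  · exact (key q hq p hp h.symm hle).symm

/-- Iterating an injection of `w + 1_B` cells into `w` cells yields an injection of countably many
cells over each point of `B` into `w` cells. -/
noncomputable def absorb (w : X → ℕ) (ψ : X × ℕ → X × ℕ) (p : X × ℕ) : X × ℕ :=
  ψ^[p.2] (ψ (p.1, w p.1))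

theorem measurable_absorb {m : MeasurableSpace X} {w : X → ℕ} (hw : Measurable w)
    {ψ : X × ℕ → X × ℕ} (hψ : Measurable ψ) : Measurable (absorb w ψ) :=
  measurable_iterate_apply hψ measurable_snd
    (hψ.comp (measurable_fst.prodMk (hw.comp measurable_fst)))

theorem absorb_spec {w e : X → ℕ} {ψ : X × ℕ → X × ℕ}
    (hinj : InjOn ψ (cells (w + e))) (hmaps : MapsTo ψ (cells (w + e)) (cells w)) :
    InjOn (absorb w ψ) {p | 0 < e p.1} ∧ MapsTo (absorb w ψ) {p | 0 < e p.1} (cells w) := by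
  have hsub : cells w ⊆ cells (w + e) := fun p hp => lt_of_lt_of_le hp (Nat.le_add_right _ _)
  have htop : ∀ x, 0 < e x → (x, w x) ∈ cells (w + e) := fun x hx => by
    simp only [cells, Pi.add_apply, mem_ofPred_eq]; omega
  have hit : ∀ n x, 0 < e x → ψ^[n] (ψ (x, w x)) ∈ cells w := by
    intro n x hx
    induction n with
    | zero => exact hmaps (htop x hx)
    | succ n ih => rw [iterate_succ_apply']; exact hmaps (hsub ih)
  refine ⟨?_, fun p hp => hit _ _ hp⟩
  have key : ∀ n k x y, 0 < e x → 0 < e y → ψ^[n] (ψ (x, w x)) = ψ^[n + k] (ψ (y, w y)) →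
      x = y ∧ k = 0 := by
    intro n
    induction n with
    | zero =>
      intro k x y hx hy h
      rcases k with _ | k
      · have := hinj (htop x hx) (htop y hy) h
        exact ⟨congrArg Prod.fst this, rfl⟩
      · exfalso
        rw [zero_add, iterate_succ_apply'] at h
        have h2 := hinj (htop x hx) (hsub (hit k y hy)) h
        have h3 := hit k y hy
        rw [← h2] at h3
        exact lt_irrefl (w x) h3
    | succ n ih =>
      intro k x y hx hy h
      rw [show n + 1 + k = (n + k) + 1 by ring, iterate_succ_apply', iterate_succ_apply'] at h
      exact ih k x y hx hy (hinj (hsub (hit n x hx)) (hsub (hit _ y hy)) h)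
  rintro ⟨x, n⟩ hx ⟨y, k⟩ hy h
  rcases le_total n k with hnk | hnk
  · obtain ⟨d, rfl⟩ := Nat.exists_eq_add_of_le hnk
    obtain ⟨rfl, rfl⟩ := key n d x y hx hy h
    rfl
  · obtain ⟨d, rfl⟩ := Nat.exists_eq_add_of_le hnk
    obtain ⟨rfl, rfl⟩ := key k d y x hy hx h.symm
    rfl

end Matching

section Data

/-- Data can be stored in cells: the points of `B`, with all their coordinates, are recovered from
the occupied cells `D` in any invariant σ-algebra that knows the allocation `ψ`. -/
theorem exists_storage {X : Type*} [mX : MeasurableSpace X] [StandardBorelSpace X] {B : Set X}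
    (hB : MeasurableSet B) {w : X → ℕ} {ψ : X × ℕ → X × ℕ} (hψ : Measurable ψ)
    (hinj : InjOn ψ {p | p.1 ∈ B}) (hmaps : MapsTo ψ {p | p.1 ∈ B} (cells w)) :
    ∃ D : ℕ → Set X, (∀ j, MeasurableSet (D j)) ∧ (∀ j, ∀ x ∈ D j, j < w x) ∧
      ∀ m : MeasurableSpace X, MeasurableSet[m] B → Measurable[m.prod ⊤, m.prod ⊤] ψ →
        (∀ j, MeasurableSet[m] (D j)) →
          ∀ E, MeasurableSet[mX] E → MeasurableSet[m] (E ∩ B) := by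
  set G := MeasurableSpace.natGeneratingSequence X
  have hG : ∀ k, MeasurableSet (G k) := MeasurableSpace.measurableSet_natGeneratingSequence
  have hgen := MeasurableSpace.generateFrom_natGeneratingSequence X
  set C : Set (X × ℕ) := {p | p.1 ∈ B ∧ p.1 ∈ G p.2} with hC
  have hCm : MeasurableSet C := by
    have : C = ⋃ k, (B ∩ G k) ×ˢ {k} := by
      ext ⟨x, k⟩; simp [hC]
    rw [this]
    exact MeasurableSet.iUnion fun k => (hB.inter (hG k)).prod (measurableSet_singleton k)
  have hCsub : C ⊆ {p | p.1 ∈ B} := fun p hp => hp.1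
  have hI : MeasurableSet (ψ '' C) := hCm.image_of_measurable_injOn hψ (hinj.mono hCsub)
  refine ⟨fun j => {x | (x, j) ∈ ψ '' C}, fun j => measurable_prodMk_right hI, ?_, ?_⟩
  · rintro j x ⟨p, hp, hpx⟩
    have := hmaps (hCsub hp)
    rw [hpx] at this
    exact this
  · intro m hBm hψm hD E hE
    have hIm : MeasurableSet[m.prod ⊤] (ψ '' C) := by
      have : ψ '' C = ⋃ j, {x | (x, j) ∈ ψ '' C} ×ˢ {j} := by
        ext ⟨x, k⟩; simp
      rw [this]
      exact MeasurableSet.iUnion fun j => (hD j).prod (MeasurableSpace.measurableSet_top)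
    have hcol : ∀ k, MeasurableSet[m] (G k ∩ B) := by
      intro k
      have : G k ∩ B = {x | ψ (x, k) ∈ ψ '' C} ∩ B := by
        ext x
        simp only [mem_inter_iff, mem_ofPred_eq]
        constructor
        · rintro ⟨h1, h2⟩
          exact ⟨⟨(x, k), ⟨h2, h1⟩, rfl⟩, h2⟩
        · rintro ⟨⟨p, hp, hpx⟩, h2⟩
          have := hinj (hCsub hp) (show (x, k) ∈ {p : X × ℕ | p.1 ∈ B} from h2) hpx
          rw [this] at hp
          exact ⟨hp.2, h2⟩
      rw [this]
      have h1 : Measurable[m, m.prod ⊤] (fun x : X => (x, k)) :=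
        @measurable_prodMk_right X ℕ m ⊤ k
      exact MeasurableSet.inter (hψm.comp h1 hIm) hBm
    rw [← hgen] at hE
    induction E, hE using MeasurableSpace.generateFrom_induction with
    | hC t ht _ =>
      obtain ⟨k, rfl⟩ := ht
      exact hcol k
    | empty => simp
    | compl t _ ih =>
      have : tᶜ ∩ B = B \ (t ∩ B) := by ext; simp; tauto
      rw [this]; exact hBm.diff ih
    | iUnion s _ ih =>
      rw [iUnion_inter]
      exact MeasurableSet.iUnion ih

end Data

section Marker

variable {X : Type*} {T : Equiv.Perm X}

/-- Any two distinct points of `B` on one orbit are at distance at least `M`. -/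
def Discrete (T : Equiv.Perm X) (M : X → ℕ) (B : Set X) : Prop :=
  ∀ x ∈ B, ∀ i : ℤ, i ≠ 0 → |i| < M x → (T ^ i) x ∉ B

theorem Discrete.mono {M : X → ℕ} {B C : Set X} (hB : Discrete T M B) (h : C ⊆ B) :
    Discrete T M C := fun x hx i hi hiM hC => hB x (h hx) i hi hiM (h hC)

theorem zpow_add_apply (T : Equiv.Perm X) (i j : ℤ) (x : X) :
    (T ^ (i + j)) x = (T ^ i) ((T ^ j) x) := by
  rw [zpow_add, Equiv.Perm.mul_apply]

theorem zpow_eq_iff (T : Equiv.Perm X) {i : ℤ} {x y : X} :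
    (T ^ i) x = y ↔ x = (T ^ (-i)) y := by
  rw [zpow_neg, Equiv.Perm.eq_inv_iff_eq]

theorem invariant_zpow {Z : Type*} {M : X → Z} (hM : ∀ x, M (T x) = M x) (i : ℤ) (x : X) :
    M ((T ^ i) x) = M x := by
  induction i with
  | zero => simp
  | succ i ih => rw [add_comm, zpow_add_apply, zpow_one, hM, ih]
  | pred i ih =>
    have h := zpow_add_apply T 1 (-(i : ℤ) - 1) x
    rw [show 1 + (-(i : ℤ) - 1) = -i by ring, zpow_one] at h
    rw [← ih, h, hM]

theorem mem_zpow_of_invariant {Y : Set X} (hY : ∀ x, T x ∈ Y ↔ x ∈ Y) (i : ℤ) (x : X) :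
    (T ^ i) x ∈ Y ↔ x ∈ Y := by
  have := invariant_zpow (T := T) (M := (· ∈ Y)) (fun x => propext (hY x)) i x
  simpa using this

theorem mem_iterate_of_invariant {Y : Set X} (hY : ∀ x, T x ∈ Y ↔ x ∈ Y) (i : ℕ) (x : X) :
    T^[i] x ∈ Y ↔ x ∈ Y := by
  have := mem_zpow_of_invariant hY i x
  rwa [zpow_natCast] at this

theorem invariant_iterate {Z : Type*} {M : X → Z} (hM : ∀ x, M (T x) = M x) (i : ℕ) (x : X) :
    M (T^[i] x) = M x := by
  have := invariant_zpow hM i x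
  rwa [zpow_natCast] at this

/-- Marker lemma: inside any set `W` there is a maximal `M`-discrete subset. -/
theorem exists_marker [mX : MeasurableSpace X] [StandardBorelSpace X] (hT : IsAuto T mX)
    (hap : ∀ x, ∀ n : ℤ, n ≠ 0 → (T ^ n) x ≠ x) {M : X → ℕ} (hM : Measurable M)
    (hMT : ∀ x, M (T x) = M x) (hpos : ∀ x, 0 < M x) {W : Set X} (hW : MeasurableSet W) :
    ∃ B ⊆ W, MeasurableSet B ∧ Discrete T M B ∧
      ∀ w ∈ W, ∃ i : ℤ, |i| < M w ∧ (T ^ i) w ∈ B := by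
  let := upgradeStandardBorel X
  obtain ⟨E, hE⟩ := ((TopologicalSpace.countable_countableBasis X).insert ∅).exists_eq_range
    (insert_nonempty _ _)
  have hEm : ∀ j, MeasurableSet (E j) := by
    intro j
    have : E j ∈ insert ∅ (TopologicalSpace.countableBasis X) := hE ▸ mem_range_self j
    rcases this with h | h
    · rw [h]; exact .empty
    · exact (TopologicalSpace.isOpen_of_mem_countableBasis h).measurableSet
  set U : ℕ → Set X := fun j => {x | x ∈ E j ∧ ∀ i : ℤ, i ≠ 0 → |i| < M x → (T ^ i) x ∉ E j} with hU
  have hTz := hT.zpow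
  have hUm : ∀ j, MeasurableSet (U j) := by
    intro j
    have := hEm j
    refine measurableSet_setOfPred.2 ((hEm j).mem.and ?_)
    refine .forall fun i => .imp (by fun_prop) (.imp ?_ ?_)
    · exact measurableSet_setOfPred.1
        (measurableSet_lt measurable_const (measurable_from_top.comp hM))
    · exact ((hEm j).mem.comp (hTz i)).not
  have hUcov : ∀ x, ∃ j, x ∈ U j := by
    intro x
    set F : Set X := (fun i : ℤ => (T ^ i) x) '' {i | i ≠ 0 ∧ |i| < M x}
    have hF : F.Finite := by
      apply Finite.image
      apply (finite_Ioo (-(M x : ℤ)) (M x)).subset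
      rintro i ⟨-, hi⟩
      exact abs_lt.1 hi
    have hxF : x ∈ Fᶜ := by
      rintro ⟨i, hi, h⟩
      exact hap x i hi.1 h
    obtain ⟨V, hV, hxV, hVF⟩ := (TopologicalSpace.isBasis_countableBasis X).exists_subset_of_mem_open
      hxF hF.isClosed.isOpen_compl
    obtain ⟨j, rfl⟩ : V ∈ range E := hE ▸ mem_insert_of_mem _ hV
    exact ⟨j, hxV, fun i hi hiM h => hVF h ⟨i, ⟨hi, hiM⟩, rfl⟩⟩
  let C : ℕ → Set X := fun n => Nat.rec ∅
    (fun j Cj => Cj ∪ {x | x ∈ U j ∧ x ∈ W ∧ ∀ i : ℤ, |i| < M x → (T ^ i) x ∉ Cj}) n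
  have hC : ∀ j, C (j + 1) = C j ∪ {x | x ∈ U j ∧ x ∈ W ∧ ∀ i : ℤ, |i| < M x → (T ^ i) x ∉ C j} :=
    fun j => rfl
  have hCm : ∀ j, MeasurableSet (C j) := by
    intro j
    induction j with
    | zero => exact .empty
    | succ j ih =>
      rw [hC]
      refine ih.union (measurableSet_setOfPred.2 ((hUm j).mem.and (hW.mem.and ?_)))
      refine .forall fun i => .imp ?_ ((ih.mem.comp (hTz i)).not)
      exact measurableSet_setOfPred.1
        (measurableSet_lt measurable_const (measurable_from_top.comp hM))
  have hCW : ∀ j, C j ⊆ W := by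
    intro j
    induction j with
    | zero => exact empty_subset _
    | succ j ih => rw [hC]; exact union_subset ih fun x hx => hx.2.1
  have hCd : ∀ j, Discrete T M (C j) := by
    intro j
    induction j with
    | zero => exact fun x hx => hx.elim
    | succ j ih =>
      rw [hC]
      rintro x (hx | hx) i hi hiM (hy | hy)
      · exact ih x hx i hi hiM hy
      · refine hy.2.2 (-i) (by rwa [abs_neg, invariant_zpow hMT]) ?_
        rw [← zpow_add_apply]; simpa using hx
      · exact hx.2.2 i hiM hy
      · exact hx.1.2 i hi hiM hy.1.1
  have hmono : Monotone C := monotone_nat_of_le_succ fun j => by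
    rw [hC]; exact subset_union_left
  refine ⟨⋃ j, C j, iUnion_subset hCW, .iUnion hCm, ?_, ?_⟩
  · intro x hx i hi hiM hy
    obtain ⟨j, hj⟩ := mem_iUnion.1 hx
    obtain ⟨j', hj'⟩ := mem_iUnion.1 hy
    exact hCd (max j j') x (hmono (le_max_left _ _) hj) i hi hiM (hmono (le_max_right _ _) hj')
  · intro w hw
    obtain ⟨j, hj⟩ := hUcov w
    rcases Classical.em (∀ i : ℤ, |i| < M w → (T ^ i) w ∉ C j) with h | h
    · refine ⟨0, by simpa using hpos w, mem_iUnion.2 ⟨j + 1, ?_⟩⟩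
      rw [hC]
      exact Or.inr ⟨hj, hw, h⟩
    · push Not at h
      obtain ⟨i, hi, hC⟩ := h
      exact ⟨i, hi, mem_iUnion.2 ⟨j, hC⟩⟩

end Marker

section Encoding

variable {X : Type*} {T : Equiv.Perm X}

theorem isAuto_generateFrom (T : Equiv.Perm X) (A : Set X) :
    IsAuto T (MeasurableSpace.generateFrom {s : Set X | ∃ n : ℤ, s = ⇑(T ^ n) '' A}) := by
  set m := MeasurableSpace.generateFrom {s : Set X | ∃ n : ℤ, s = ⇑(T ^ n) '' A}
  have himage : ∀ (S : Equiv.Perm X) (n k : ℤ), S * T ^ n = T ^ k →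
      MeasurableSet[m] (S '' ((T ^ n) '' A)) := by
    intro S n k h
    apply MeasurableSpace.measurableSet_generateFrom
    refine ⟨k, ?_⟩
    rw [← h, image_image]
    rfl
  constructor
  · refine @measurable_generateFrom _ _ m _ _ ?_
    rintro _ ⟨n, rfl⟩
    rw [← Equiv.image_symm_eq_preimage]
    exact himage T⁻¹ n (n - 1) (by group)
  · refine @measurable_generateFrom _ _ m _ _ ?_
    rintro _ ⟨n, rfl⟩
    rw [← Equiv.image_eq_preimage_symm]
    exact himage T n (n + 1) (by group)

theorem exists_generator_of_code [mX : MeasurableSpace X] (hT : IsAuto T mX)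
    {M : X → ℕ} (hMT : ∀ x, M (T x) = M x) (hM3 : ∀ x, 3 ≤ M x) {B : Set X}
    (hB : MeasurableSet B) (hdisc : Discrete T M B) (hrec : ∀ x, ∃ n : ℤ, (T ^ n) x ∈ B)
    {D : ℕ → Set X} (hD : ∀ j, MeasurableSet (D j)) (hDB : ∀ j, D j ⊆ B)
    (hDM : ∀ j, ∀ b ∈ D j, 2 * j + 5 ≤ M b)
    (hcode : ∀ m : MeasurableSpace X, IsAuto T m → MeasurableSet[m] B →
      (∀ j, MeasurableSet[m] (D j)) → ∀ E, MeasurableSet[mX] E → MeasurableSet[m] (E ∩ B)) :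
    ∃ A : Set X, MeasurableSet A ∧
      MeasurableSpace.generateFrom {s : Set X | ∃ n : ℤ, s = ⇑(T ^ n) '' A} = mX := by
  set O : ℕ → Set X := fun o => {b | b ∈ B ∧ (o = 0 ∨ o = 1 ∨ ∃ j, b ∈ D j ∧ o = 2 * j + 3)} with hO
  have hOm : ∀ o, MeasurableSet (O o) := by
    intro o
    have : O o = {b | b ∈ B ∧ o = 0} ∪ {b | b ∈ B ∧ o = 1} ∪ ⋃ j, {b | b ∈ D j ∧ o = 2 * j + 3} := by
      ext b
      simp only [hO, mem_ofPred_eq, mem_union, mem_iUnion]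
      constructor
      · rintro ⟨h1, h | h | ⟨j, h⟩⟩
        exacts [Or.inl (Or.inl ⟨h1, h⟩), Or.inl (Or.inr ⟨h1, h⟩), Or.inr ⟨j, h⟩]
      · rintro ((⟨h1, h⟩ | ⟨h1, h⟩) | ⟨j, h⟩)
        exacts [⟨h1, Or.inl h⟩, ⟨h1, Or.inr (Or.inl h)⟩, ⟨hDB j h.1, Or.inr (Or.inr ⟨j, h⟩)⟩]
    rw [this]
    exact ((hB.inter (.const _)).union (hB.inter (.const _))).union
      (.iUnion fun j => (hD j).inter (.const _))
  have hOM : ∀ o, ∀ b ∈ O o, o + 1 < M b := by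
    rintro o b ⟨hb, h | h | ⟨j, hj, h⟩⟩
    · have := hM3 b; omega
    · have := hM3 b; omega
    · have := hDM j b hj; omega
  have huniq : ∀ b ∈ B, ∀ b' ∈ B, ∀ o o' : ℕ, o < M b → o' < M b' → (T ^ (o : ℤ)) b = (T ^ (o' : ℤ)) b' →
      o = o' ∧ b = b' := by
    intro b hb b' hb' o o' ho ho' h
    have h1 : (T ^ ((o : ℤ) - o')) b = b' := by
      rw [sub_eq_add_neg, add_comm, zpow_add_apply, h, ← zpow_add_apply]; simp
    have h2 : M b' = M b := by rw [← h1, invariant_zpow hMT]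
    have h3 : o = o' := by
      by_contra hne
      refine hdisc b hb ((o : ℤ) - o') (by omega) (by rw [abs_lt]; omega) (h1 ▸ hb')
    subst h3
    exact ⟨rfl, by simpa using h1⟩
  set A : Set X := {x | ∃ o : ℕ, (T ^ (-(o : ℤ))) x ∈ O o} with hA
  have hAm : MeasurableSet A := by
    have : A = ⋃ o : ℕ, (T ^ (-(o : ℤ))) ⁻¹' O o := by ext; simp [hA]
    rw [this]
    exact .iUnion fun o => hT.zpow _ (hOm o)
  have hAiff : ∀ x, x ∈ A ↔ ∃ o : ℕ, ∃ b ∈ O o, x = (T ^ (o : ℤ)) b := by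
    intro x
    constructor
    · rintro ⟨o, ho⟩
      exact ⟨o, _, ho, by rw [← zpow_add_apply]; simp⟩
    · rintro ⟨o, b, hb, rfl⟩
      exact ⟨o, by rw [← zpow_add_apply]; simpa using hb⟩
  have hBA : B = {x | x ∈ A ∧ T x ∈ A} := by
    ext x
    simp only [mem_ofPred_eq, hAiff]
    constructor
    · intro hx
      exact ⟨⟨0, x, ⟨hx, by simp⟩, by simp⟩, ⟨1, x, ⟨hx, by simp⟩, by simp⟩⟩
    · rintro ⟨⟨o, b, hb, rfl⟩, ⟨o', b', hb', h⟩⟩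
      rw [← Equiv.Perm.mul_apply, ← zpow_one_add] at h
      have h0 := hOM o b hb
      obtain ⟨h1, rfl⟩ := huniq b hb.1 b' hb'.1 (1 + o) o' (by omega) (by have := hOM _ _ hb'; omega)
        (by push_cast; exact h)
      have : o = 0 := by
        rcases hb.2 with h | h | ⟨j, -, h⟩ <;> rcases hb'.2 with h' | h' | ⟨j', -, h'⟩ <;> omega
      subst this
      simpa using hb.1
  have hDA : ∀ j, D j = {b | b ∈ B ∧ (T ^ ((2 * j + 3 : ℕ) : ℤ)) b ∈ A ∧
      ∀ i : ℕ, 0 < i → i ≤ 2 * j + 3 → (T ^ (i : ℤ)) b ∉ B} := by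
    intro j
    ext b
    simp only [mem_ofPred_eq, hAiff]
    constructor
    · intro hb
      refine ⟨hDB j hb, ⟨_, b, ⟨hDB j hb, Or.inr (Or.inr ⟨j, hb, rfl⟩)⟩, rfl⟩, ?_⟩
      intro i hi0 hi
      have := hDM j b hb
      exact hdisc b (hDB j hb) i (by omega) (by rw [abs_lt]; omega)
    · rintro ⟨hb, ⟨o, b', hb', h⟩, hi⟩
      have hle : 2 * j + 3 ≤ o := by
        by_contra hlt
        refine hi (2 * j + 3 - o) (by omega) (by omega) ?_
        have : (T ^ ((2 * j + 3 - o : ℕ) : ℤ)) b = b' := by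
          rw [Nat.cast_sub (by omega), sub_eq_add_neg, add_comm, zpow_add_apply, h,
            ← zpow_add_apply]
          simp
        rw [this]; exact hb'.1
      have h1 := hOM o b' hb'
      obtain ⟨h2, rfl⟩ := huniq b' hb'.1 b hb (o - (2 * j + 3)) 0 (by omega) (by have := hM3 b; omega) (by
        rw [Nat.cast_sub (by omega), sub_eq_add_neg, add_comm, zpow_add_apply, ← h,
            ← zpow_add_apply]
        simp)
      rcases hb'.2 with h' | h' | ⟨j', hj', h'⟩
      · omega
      · omega
      · obtain rfl : j = j' := by omega
        exact hj'
  refine ⟨A, hAm, le_antisymm ?_ ?_⟩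
  · apply MeasurableSpace.generateFrom_le
    rintro _ ⟨n, rfl⟩
    rw [Equiv.image_eq_preimage_symm]
    have := hT.zpow (-n) hAm
    rwa [zpow_neg] at this
  · set m := MeasurableSpace.generateFrom {s : Set X | ∃ n : ℤ, s = ⇑(T ^ n) '' A} with hm
    have hTm : IsAuto T m := isAuto_generateFrom T A
    have hAm' : MeasurableSet[m] A :=
      MeasurableSpace.measurableSet_generateFrom ⟨0, by simp⟩
    have hBm : MeasurableSet[m] B := by
      rw [hBA]
      exact hAm'.inter (hTm.1 hAm')
    have hDm : ∀ j, MeasurableSet[m] (D j) := by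
      intro j
      rw [hDA j]
      refine measurableSet_setOfPred.2 (hBm.mem.and ((hAm'.mem.comp (hTm.zpow _)).and ?_))
      exact .forall fun i => .imp measurable_const (.imp measurable_const
        (hBm.mem.comp (hTm.zpow _)).not)
    intro E hE
    have : E = ⋃ n : ℤ, (T ^ n) ⁻¹' (((T ^ (-n)) ⁻¹' E) ∩ B) := by
      ext x
      simp only [mem_iUnion, mem_preimage, mem_inter_iff, ← zpow_add_apply, neg_add_cancel,
        zpow_zero, Equiv.Perm.one_apply]
      exact ⟨fun h => (hrec x).imp fun n hn => ⟨h, hn⟩, fun ⟨n, h, _⟩ => h⟩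
    rw [this]
    exact .iUnion fun n => hTm.zpow n (hcode m hTm hBm hDm _ (hT.zpow _ hE))

end Encoding

section Empirical

variable {Y Z : Type*} [MeasurableSpace Y] [MeasurableSpace Z]

/-- The empirical measure of the first `N + 1` terms of a sequence. -/
noncomputable def empirical (y : ℕ → Y) (N : ℕ) : Measure Y :=
  ((N + 1 : ℕ) : ℝ≥0∞)⁻¹ • ∑ i ∈ Finset.range (N + 1), Measure.dirac (y i)

instance (y : ℕ → Y) (N : ℕ) : IsProbabilityMeasure (empirical y N) := by
  constructor
  simp only [empirical, Measure.smul_apply, Measure.coe_finsetSum, Finset.sum_apply,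
    measure_univ, Finset.sum_const, Finset.card_range, smul_eq_mul, nsmul_eq_mul, mul_one]
  exact ENNReal.inv_mul_cancel (by simp) (by simp)

theorem empirical_apply [MeasurableSingletonClass Y] (y : ℕ → Y) (N : ℕ) (S : Set Y) :
    empirical y N S = ENNReal.ofReal
      ((∑ i ∈ Finset.range (N + 1), S.indicator 1 (y i)) / (N + 1 : ℕ)) := by
  simp only [empirical, Measure.smul_apply, Measure.coe_finsetSum, Finset.sum_apply,
    Measure.dirac_apply, smul_eq_mul]
  rw [ENNReal.ofReal_div_of_pos (by positivity), ENNReal.ofReal_sum_of_nonneg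
    (fun i _ => indicator_nonneg (f := (1 : Y → ℝ)) (fun _ _ => zero_le_one) _), ENNReal.ofReal_natCast,
    ENNReal.div_eq_inv_mul]
  congr 1
  refine Finset.sum_congr rfl fun i _ => ?_
  by_cases h : y i ∈ S <;> simp [h]

theorem integral_empirical [MeasurableSingletonClass Y] (y : ℕ → Y) (N : ℕ) (g : Y → ℝ) :
    ∫ x, g x ∂(empirical y N) = (∑ i ∈ Finset.range (N + 1), g (y i)) / (N + 1 : ℕ) := by
  rw [empirical, integral_smul_measure, integral_finsetSum_measure
    (fun i _ => integrable_dirac (by simp))]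
  simp only [integral_dirac, smul_eq_mul, ENNReal.toReal_inv, ENNReal.toReal_natCast,
    div_eq_inv_mul]

theorem exists_isProbabilityMeasure_map_eq [TopologicalSpace Y] [T2Space Y]
    [BorelSpace Y] [MeasurableSingletonClass Y] [TopologicalSpace Z] [HasOuterApproxClosed Z]
    [BorelSpace Z] {p q : Y → Z} (hp : Continuous p) (hq : Continuous q) {y : ℕ → Y}
    (hy : ∀ n, q (y n) = p (y (n + 1))) (htight : IsTightMeasureSet (range (empirical y))) :
    ∃ μ : Measure Y, IsProbabilityMeasure μ ∧ μ.map p = μ.map q := by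
  let ν : ℕ → ProbabilityMeasure Y := fun N => ⟨empirical y N, inferInstance⟩
  have hcomp : IsCompact (closure (range ν)) := by
    apply isCompact_closure_of_isTightMeasureSet
    convert htight using 1
    ext μ
    constructor
    · rintro ⟨_, ⟨N, rfl⟩, rfl⟩; exact ⟨N, rfl⟩
    · rintro ⟨N, rfl⟩; exact ⟨_, ⟨N, rfl⟩, rfl⟩
  obtain ⟨μ, -, hμ⟩ := hcomp.exists_mapClusterPt (f := atTop) (u := ν)
    (by simpa using ⟨0, fun b _ => subset_closure (mem_range_self b)⟩)
  have hcont : ∀ g : Y →ᵇ ℝ, Continuous fun ρ : ProbabilityMeasure Y => ∫ x, g x ∂(ρ : Measure Y) := by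
    intro g
    exact continuous_iff_continuousAt.2 fun ρ =>
      ProbabilityMeasure.tendsto_iff_forall_integral_tendsto.1 tendsto_id g
  refine ⟨μ, inferInstance, ?_⟩
  have : IsProbabilityMeasure ((μ : Measure Y).map p) :=
    Measure.isProbabilityMeasure_map hp.measurable.aemeasurable
  have : IsProbabilityMeasure ((μ : Measure Y).map q) :=
    Measure.isProbabilityMeasure_map hq.measurable.aemeasurable
  apply ext_of_forall_integral_eq_of_IsFiniteMeasure
  intro g
  rw [integral_map hp.measurable.aemeasurable g.continuous.aestronglyMeasurable,
    integral_map hq.measurable.aemeasurable g.continuous.aestronglyMeasurable]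
  let gp : Y →ᵇ ℝ := g.compContinuous ⟨p, hp⟩
  let gq : Y →ᵇ ℝ := g.compContinuous ⟨q, hq⟩
  have h1 : Tendsto (fun N => ∫ x, gp x ∂(ν N : Measure Y) - ∫ x, gq x ∂(ν N : Measure Y))
      atTop (𝓝 0) := by
    have h2 : ∀ N, ∫ x, gp x ∂(ν N : Measure Y) - ∫ x, gq x ∂(ν N : Measure Y) =
        (g (p (y 0)) - g (p (y (N + 1)))) / (N + 1 : ℕ) := by
      intro N
      change ∫ x, gp x ∂(empirical y N) - ∫ x, gq x ∂(empirical y N) = _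
      rw [integral_empirical, integral_empirical, ← sub_div, ← Finset.sum_sub_distrib]
      congr 1
      have : ∀ i, gp (y i) - gq (y i) = g (p (y i)) - g (p (y (i + 1))) := fun i => by
        simp [gp, gq, hy]
      simp only [this]
      exact Finset.sum_range_sub' (fun i => g (p (y i))) (N + 1)
    simp only [h2]
    have h3 : Tendsto (fun N : ℕ => (2 * ‖g‖) / ((N + 1 : ℕ) : ℝ)) atTop (𝓝 0) :=
      (tendsto_const_nhds.div_atTop tendsto_natCast_atTop_atTop).comp (tendsto_add_atTop_nat 1)
    refine squeeze_zero_norm (fun N => ?_) h3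
    rw [norm_div, Real.norm_natCast]
    gcongr
    calc _ ≤ ‖g (p (y 0))‖ + ‖g (p (y (N + 1)))‖ := norm_sub_le _ _
      _ ≤ _ := by have := g.norm_coe_le_norm (p (y 0)); have := g.norm_coe_le_norm (p (y (N+1))); linarith
  have h4 : MapClusterPt (∫ x, gp x ∂(μ : Measure Y) - ∫ x, gq x ∂(μ : Measure Y)) atTop
      (fun N => ∫ x, gp x ∂(ν N : Measure Y) - ∫ x, gq x ∂(ν N : Measure Y)) :=
    hμ.continuousAt_comp (f := fun ρ : ProbabilityMeasure Y => ∫ x, gp x ∂(ρ : Measure Y) - ∫ x, gq x ∂(ρ : Measure Y))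
      ((hcont gp).sub (hcont gq)).continuousAt
  have h5 : ∫ x, gp x ∂(μ : Measure Y) - ∫ x, gq x ∂(μ : Measure Y) = 0 := by
    have : ClusterPt _ (𝓝 (0 : ℝ)) := ClusterPt.mono h4 h1
    exact eq_of_nhds_neBot this
  exact sub_eq_zero.1 h5

theorem isTightMeasureSet_empirical {Y : Type*} [MeasurableSpace Y] [MetricSpace Y]
    [CompleteSpace Y] [BorelSpace Y] {s : ℕ → Y}
    {c : ℕ → Y → ℕ} (hc : ∀ i x, dist x (s (c i x)) < 1 / ((i : ℝ) + 1)) {y : ℕ → Y}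
    (h : ∀ i, ∀ ε : ℝ, 0 < ε → ∃ n, ∀ᶠ N in atTop,
      ∑ j ∈ Finset.range N, {x | n ≤ c i x}.indicator (1 : Y → ℝ) (y j) < ε * N) :
    IsTightMeasureSet (range (empirical y)) := by
  rw [isTightMeasureSet_iff_exists_isCompact_measure_compl_le]
  intro ε hε
  obtain ⟨ε', hε'0, hε'⟩ := ENNReal.exists_pos_sum_of_countable' hε.ne' ℕ
  have key : ∀ i, ∃ n, ∀ N, empirical y N {x | n ≤ c i x} ≤ ε' i := by
    intro i
    have hfin : min (ε' i) 1 ≠ ∞ := by simp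
    have hpos : 0 < min (ε' i) 1 := lt_min (hε'0 i) one_pos
    obtain ⟨n, hn⟩ := h i (min (ε' i) 1).toReal (ENNReal.toReal_pos hpos.ne' hfin)
    obtain ⟨N₀, hN₀⟩ := eventually_atTop.1 hn
    refine ⟨max n ((Finset.range N₀).sup (fun j => c i (y j)) + 1), fun N => ?_⟩
    refine le_trans ?_ (min_le_left (ε' i) 1)
    rw [empirical_apply]
    rcases lt_or_ge N N₀ with hN | hN
    · have : ∑ j ∈ Finset.range (N + 1), {x | max n ((Finset.range N₀).sup (fun j => c i (y j)) + 1)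
          ≤ c i x}.indicator (1 : Y → ℝ) (y j) = 0 := by
        refine Finset.sum_eq_zero fun j hj => indicator_of_notMem ?_ _
        have h1 := Finset.le_sup (f := fun j => c i (y j)) (s := Finset.range N₀) (b := j)
          (by simp at hj ⊢; omega)
        simp only [mem_ofPred_eq, not_le]
        exact lt_of_lt_of_le (Nat.lt_succ_of_le h1) (le_max_right _ _)
      rw [this]; simp
    · apply ENNReal.ofReal_le_of_le_toReal
      rw [div_le_iff₀ (by positivity)]
      refine le_trans (Finset.sum_le_sum fun j _ => ?_) (hN₀ (N + 1) (by omega)).le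
      exact indicator_le_indicator_of_subset (fun x (hx : _ ≤ c i x) => (le_max_left _ _).trans hx)
        (fun _ => zero_le_one) _
  choose n hn using key
  set K : Set Y := ⋂ i, {x | c i x < n i} with hK
  refine ⟨closure K, ?_, ?_⟩
  · refine (TotallyBounded.closure ?_).isCompact_of_isClosed isClosed_closure
    rw [Metric.totallyBounded_iff]
    intro r hr
    obtain ⟨i, hi⟩ := exists_nat_one_div_lt hr
    refine ⟨s '' (Finset.range (n i) : Set ℕ), (Finset.finite_toSet _).image _, fun x hx => ?_⟩
    have hx' : c i x < n i := mem_iInter.1 hx i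
    simp only [mem_iUnion, Metric.mem_ball]
    exact ⟨s (c i x), mem_image_of_mem _ (by simpa using hx'), (hc i x).trans hi⟩
  · rintro _ ⟨N, rfl⟩
    calc empirical y N (closure K)ᶜ ≤ empirical y N (⋃ i, {x | n i ≤ c i x}) := by
          apply measure_mono
          intro x hx
          have : x ∉ K := fun h => hx (subset_closure h)
          simpa [hK] using this
      _ ≤ ∑' i, empirical y N {x | n i ≤ c i x} := measure_iUnion_le _
      _ ≤ ∑' i, ε' i := ENNReal.tsum_le_tsum fun i => hn i N
      _ ≤ ε := hε'.le

theorem exists_nontight_of_continuous [TopologicalSpace Y] [PolishSpace Y]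
    [BorelSpace Y] [Nonempty Y] [TopologicalSpace Z] [HasOuterApproxClosed Z]
    [BorelSpace Z] {p q : Y → Z} (hp : Continuous p) (hq : Continuous q) {S : Y → Y}
    (hS : ∀ y, q y = p (S y))
    (hno : ¬ ∃ μ : Measure Y, IsProbabilityMeasure μ ∧ μ.map p = μ.map q) :
    ∃ c : ℕ → Y → ℕ, (∀ i, Measurable (c i)) ∧ ∀ x, ∃ i, ∃ ε : ℝ, 0 < ε ∧ ∀ n, ∃ᶠ N in atTop,
      ε * N ≤ birkhoffSum S ({x | n ≤ c i x}.indicator (1 : Y → ℝ)) N x := by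
  let := TopologicalSpace.upgradeIsCompletelyMetrizable Y
  set s := TopologicalSpace.denseSeq Y
  have hex : ∀ (i : ℕ) (x : Y), ∃ n, dist x (s n) < 1 / ((i : ℝ) + 1) := fun i x =>
    (TopologicalSpace.denseRange_denseSeq Y).exists_dist_lt x (by positivity)
  refine ⟨fun i x => sInf {n | dist x (s n) < 1 / ((i : ℝ) + 1)}, fun i => ?_, fun x => ?_⟩
  · refine measurable_sInf_nat fun n => ?_
    exact measurableSet_lt (by fun_prop) measurable_const
  by_contra! hcon
  refine hno (exists_isProbabilityMeasure_map_eq hp hq (y := fun n => S^[n] x) (fun n => ?_)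
    (isTightMeasureSet_empirical (s := s) (c := fun i x => sInf {n | dist x (s n) < 1 / ((i : ℝ) + 1)})
      (fun i x => Nat.sInf_mem (s := {n | dist x (s n) < 1 / ((i : ℝ) + 1)}) (hex i x)) ?_))
  · rw [hS, iterate_succ_apply']
  · intro i ε hε
    obtain ⟨n, hn⟩ := hcon i ε hε
    exact ⟨n, hn⟩

end Empirical

section Invariant

variable {X : Type*} [mX : MeasurableSpace X] [StandardBorelSpace X] {T : Equiv.Perm X}

theorem aperiodic_of_no_invariant_measure
    (hno : ¬ ∃ μ : Measure X, IsProbabilityMeasure μ ∧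
      ∀ E : Set X, MeasurableSet E → μ (⇑T ⁻¹' E) = μ E) :
    ∀ x, ∀ n : ℤ, n ≠ 0 → (T ^ n) x ≠ x := by
  have key : ∀ x, ∀ n : ℕ, T^[n + 1] x ≠ x := by
    intro x n hx
    refine hno ⟨empirical (fun i => T^[i] x) n, inferInstance, fun E hE => ?_⟩
    rw [empirical_apply, empirical_apply]
    congr 2
    have : ∀ i, (T ⁻¹' E).indicator (1 : X → ℝ) (T^[i] x) = E.indicator 1 (T^[i + 1] x) := by
      intro i
      rw [iterate_succ_apply']
      rfl
    simp only [this]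
    rw [Finset.sum_range_succ, Finset.sum_range_succ' _ n, hx]
    rfl
  intro x n hn hx
  obtain ⟨k, rfl | rfl⟩ := n.eq_nat_or_neg
  · obtain ⟨j, rfl⟩ : ∃ j, k = j + 1 := ⟨k - 1, by omega⟩
    refine key x j ?_
    rwa [zpow_natCast, ← Equiv.Perm.iterate_eq_pow] at hx
  · obtain ⟨j, rfl⟩ : ∃ j, k = j + 1 := ⟨k - 1, by omega⟩
    refine key x j ?_
    rw [zpow_eq_iff, neg_neg] at hx
    rw [zpow_natCast, ← Equiv.Perm.iterate_eq_pow] at hx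
    exact hx.symm

theorem exists_nontight (hT : IsAuto T mX)
    (hno : ¬ ∃ μ : Measure X, IsProbabilityMeasure μ ∧
      ∀ E : Set X, MeasurableSet E → μ (⇑T ⁻¹' E) = μ E) :
    ∃ c : ℕ → X → ℕ, (∀ i, Measurable (c i)) ∧ ∀ x, ∃ i, ∃ ε : ℝ, 0 < ε ∧ ∀ n, ∃ᶠ N in atTop,
      ε * N ≤ birkhoffSum T ({x | n ≤ c i x}.indicator (1 : X → ℝ)) N x := by
  rcases isEmpty_or_nonempty X with hX | hX
  · exact ⟨fun _ _ => 0, fun _ => measurable_const, fun x => (hX.false x).elim⟩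
  let t₀ := upgradeStandardBorel X
  have hborel₀ : @BorelSpace X t₀.toTopologicalSpace mX := inferInstance
  have hpol₀ : @PolishSpace X t₀.toTopologicalSpace := inferInstance
  have happrox : @HasOuterApproxClosed X t₀.toTopologicalSpace := inferInstance
  obtain ⟨t₁, hle, hcont, hpol⟩ := hT.1.exists_continuous
  have hborel : @BorelSpace X t₁ mX := by
    refine @BorelSpace.mk X t₁ mX ?_
    rw [@BorelSpace.measurable_eq X t₀.toTopologicalSpace mX hborel₀]
    exact (borel_eq_borel_of_le hpol hpol₀ hle).symm
  have hid : @Continuous X X t₁ t₀.toTopologicalSpace id := continuous_id_iff_le.2 hle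
  refine @exists_nontight_of_continuous X X mX mX t₁ hpol hborel hX
    t₀.toTopologicalSpace happrox hborel₀ id T hid hcont T (fun _ => rfl) ?_
  rintro ⟨μ, hμ, h⟩
  refine hno ⟨μ, hμ, fun E hE => ?_⟩
  rw [← Measure.map_apply hT.1 hE, ← h, Measure.map_id]

end Invariant

section Selection

variable {X : Type*} [MeasurableSpace X] {T : Equiv.Perm X}

theorem exists_invariant_selection {ι : Type*} [Countable ι] [Nonempty ι] {P : ι → X → Prop}
    (hP : ∀ a, MeasurableSet {x | P a x}) (hPT : ∀ a x, P a (T x) ↔ P a x) :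
    ∃ (e : ℕ → ι) (J : X → ℕ), Measurable J ∧ (∀ x, J (T x) = J x) ∧
      ∀ x, (∃ a, P a x) → P (e (J x)) x := by
  obtain ⟨e, he⟩ := exists_surjective_nat ι
  refine ⟨e, fun x => sInf {n | P (e n) x}, measurable_sInf_nat fun n => hP _, fun x => ?_, ?_⟩
  · simp only [hPT]
  · rintro x ⟨a, ha⟩
    obtain ⟨n, rfl⟩ := he a
    exact Nat.sInf_mem (s := {n | P (e n) x}) ⟨n, ha⟩

theorem measurable_select {Z : Type*} [MeasurableSpace Z] {J : X → ℕ} (hJ : Measurable J)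
    {F : ℕ → X → Z} (hF : ∀ n, Measurable (F n)) : Measurable fun x => F (J x) x := by
  have : Measurable fun q : ℕ × X => F q.1 q.2 := measurable_from_prod_countable_right hF
  exact this.comp (hJ.prodMk measurable_id)

end Selection

section Averages

variable {X : Type*} {T : Equiv.Perm X}

/-- The upper Birkhoff average of `f` at `x` is greater than `r`. -/
def UpperAverageGT (T : Equiv.Perm X) (f : X → ℝ) (r : ℝ) (x : X) : Prop :=
  ∃ k : ℕ, ∃ᶠ N : ℕ in atTop, (r + 1 / ((k : ℝ) + 1)) * (N : ℝ) ≤ birkhoffSum T f N x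

theorem measurableSet_upperAverageGT [mX : MeasurableSpace X] (hT : Measurable T) {f : X → ℝ}
    (hf : Measurable f) (r : ℝ) : MeasurableSet {x | UpperAverageGT T f r x} := by
  simp only [UpperAverageGT, frequently_atTop]
  refine measurableSet_setOfPred.2 (.exists fun k => .forall fun a => .exists fun N =>
    measurable_const.and (measurableSet_setOfPred.1 ?_))
  exact measurableSet_le measurable_const (measurable_birkhoffSum hT hf N)

theorem abs_birkhoffSum_apply_sub_le {f : X → ℝ} {C : ℝ} (hf : ∀ x, |f x| ≤ C) (N : ℕ) (x : X) :
    |birkhoffSum T f N (T x) - birkhoffSum T f N x| ≤ 2 * C := by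
  rw [birkhoffSum_apply_sub_birkhoffSum]
  refine (abs_sub _ _).trans ?_
  linarith [hf (T^[N] x), hf x]

theorem UpperAverageGT.congr {f : X → ℝ} {r C : ℝ} {x y : X} (h : UpperAverageGT T f r x)
    (hxy : ∀ N, |birkhoffSum T f N y - birkhoffSum T f N x| ≤ C) : UpperAverageGT T f r y := by
  obtain ⟨k, hk⟩ := h
  refine ⟨k + 1, ?_⟩
  obtain ⟨N₀, hN₀⟩ := exists_nat_ge (C * (((k : ℝ) + 1) * ((k : ℝ) + 2)))
  refine (hk.and_eventually (eventually_ge_atTop N₀)).mono ?_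
  rintro N ⟨h1, h2⟩
  have h3 := (abs_le.1 (hxy N)).1
  have h4 : C ≤ N / (((k : ℝ) + 1) * ((k : ℝ) + 2)) := by
    rw [le_div_iff₀ (by positivity)]
    exact hN₀.trans (by exact_mod_cast h2)
  have h5 : (N : ℝ) / (((k : ℝ) + 1) * ((k : ℝ) + 2)) = 1 / ((k : ℝ) + 1) * N -
      1 / (((k + 1 : ℕ) : ℝ) + 1) * N := by
    push_cast
    field_simp
    ring
  linarith

theorem upperAverageGT_apply_iff {f : X → ℝ} {C : ℝ} (hf : ∀ x, |f x| ≤ C) (r : ℝ) (x : X) :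
    UpperAverageGT T f r (T x) ↔ UpperAverageGT T f r x :=
  ⟨fun h => h.congr fun N => by rw [abs_sub_comm]; exact abs_birkhoffSum_apply_sub_le hf N x,
    fun h => h.congr fun N => abs_birkhoffSum_apply_sub_le hf N x⟩

theorem UpperAverageGT.frequently {f : X → ℝ} {r : ℝ} {x : X} (h : UpperAverageGT T f r x) :
    ∃ᶠ N : ℕ in atTop, r * (N : ℝ) ≤ birkhoffSum T f N x := by
  obtain ⟨k, hk⟩ := h
  refine hk.mono fun N hN => le_trans ?_ hN
  have : 0 ≤ 1 / ((k : ℝ) + 1) * N := by positivity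
  linarith

theorem upperAverageGT_of_lt {f : X → ℝ} {r s : ℝ} {x : X} (hrs : r < s)
    (h : ∃ᶠ N : ℕ in atTop, s * (N : ℝ) ≤ birkhoffSum T f N x) : UpperAverageGT T f r x := by
  obtain ⟨k, hk⟩ := exists_nat_one_div_lt (sub_pos.2 hrs)
  refine ⟨k, h.mono fun N hN => le_trans ?_ hN⟩
  gcongr
  linarith

theorem birkhoffSum_congr_orbit {R : Type*} [AddCommMonoid R] {f g : X → R} {x : X}
    (h : ∀ i : ℕ, f (T^[i] x) = g (T^[i] x)) (N : ℕ) :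
    birkhoffSum T f N x = birkhoffSum T g N x :=
  Finset.sum_congr rfl fun i _ => h i

theorem abs_indicator_le_one (S : Set X) (x : X) : |S.indicator (1 : X → ℝ) x| ≤ 1 := by
  by_cases h : x ∈ S <;> simp [h]

theorem birkhoffSum_sub_const (f : X → ℝ) (r : ℝ) (N : ℕ) (x : X) :
    birkhoffSum T (fun y => f y - r) N x = birkhoffSum T f N x - r * N := by
  simp [birkhoffSum, Finset.sum_sub_distrib, mul_comm]

theorem birkhoffSum_const_sub (f : X → ℝ) (r : ℝ) (N : ℕ) (x : X) :
    birkhoffSum T (fun y => r - f y) N x = r * N - birkhoffSum T f N x := by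
  simp [birkhoffSum, Finset.sum_sub_distrib, mul_comm]

theorem exists_tendsto_of_not_oscillating {f : X → ℝ} (hf0 : ∀ x, 0 ≤ f x) (hf1 : ∀ x, f x ≤ 1)
    {x : X} (h : ∀ (r : ℚ) (k : ℕ), 0 ≤ r → r ≤ 1 →
      UpperAverageGT T (fun y => f y - r) (1 / ((k : ℝ) + 1)) x →
      ¬ UpperAverageGT T (fun y => r - f y) (1 / ((k : ℝ) + 1)) x) :
    ∃ l, Tendsto (fun N : ℕ => birkhoffSum T f N x / N) atTop (𝓝 l) := by
  have hb0 : ∀ N : ℕ, 0 ≤ birkhoffSum T f N x / N := fun N =>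
    div_nonneg (Finset.sum_nonneg fun i _ => hf0 _) (by positivity)
  have hb1 : ∀ N : ℕ, birkhoffSum T f N x / N ≤ 1 := fun N => by
    refine div_le_one_of_le₀ ?_ (by positivity)
    calc birkhoffSum T f N x ≤ ∑ i ∈ Finset.range N, (1 : ℝ) := Finset.sum_le_sum fun i _ => hf1 _
      _ = N := by simp
  refine tendsto_of_no_upcrossings (s := range ((↑) : ℚ → ℝ)) Rat.denseRange_cast ?_
    (isBoundedUnder_of ⟨1, hb1⟩) (isBoundedUnder_of ⟨0, hb0⟩)
  rintro _ ⟨a, rfl⟩ _ ⟨b, rfl⟩ hab ⟨h1, h2⟩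
  have hab' : (0 : ℝ) < (b - a) / 4 := by linarith
  obtain ⟨k, hk⟩ := exists_nat_one_div_lt hab'
  obtain ⟨N₁, hN₁⟩ := h1.exists
  obtain ⟨N₂, hN₂⟩ := h2.exists
  have ha0 : (0 : ℝ) < a := (hb0 N₁).trans_lt hN₁
  have hb1' : (b : ℝ) < 1 := hN₂.trans_le (hb1 N₂)
  refine h ((a + b) / 2) k ?_ ?_ ?_ ?_
  · have : (0 : ℝ) ≤ ((a + b) / 2 : ℚ) := by push_cast; linarith
    exact_mod_cast this
  · have : (((a + b) / 2 : ℚ) : ℝ) ≤ 1 := by push_cast; linarith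
    exact_mod_cast this
  · refine upperAverageGT_of_lt hk ?_
    refine (h2.and_eventually (eventually_gt_atTop 0)).mono ?_
    rintro N ⟨hN, hN0⟩
    have hN0' : (0 : ℝ) < N := by exact_mod_cast hN0
    rw [lt_div_iff₀ hN0'] at hN
    rw [birkhoffSum_sub_const]
    push_cast
    nlinarith
  · refine upperAverageGT_of_lt hk ?_
    refine (h1.and_eventually (eventually_gt_atTop 0)).mono ?_
    rintro N ⟨hN, hN0⟩
    have hN0' : (0 : ℝ) < N := by exact_mod_cast hN0
    rw [div_lt_iff₀ hN0'] at hN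
    rw [birkhoffSum_const_sub]
    push_cast
    nlinarith

end Averages

section Dichotomy

variable {X : Type*} [mX : MeasurableSpace X] {T : Equiv.Perm X}

theorem exists_divergent_of_oscillating (hT : Measurable T) {ι : Type*} [Countable ι] [Nonempty ι]
    {f : ι → X → ℝ} (hf : ∀ a, Measurable (f a)) (hf0 : ∀ a x, 0 ≤ f a x) (hf1 : ∀ a x, f a x ≤ 1) :
    ∃ Y : Set X, MeasurableSet Y ∧ (∀ x, T x ∈ Y ↔ x ∈ Y) ∧
      (∃ κ : X → ℕ, Measurable κ ∧ (∀ x, κ (T x) = κ x) ∧ (∀ x, 0 < κ x) ∧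
        ∃ g : X → ℝ, Measurable g ∧ (∀ x, |g x| ≤ 1) ∧ ∀ x ∈ Y,
          (∃ᶠ N : ℕ in atTop, (N : ℝ) ≤ κ x * birkhoffSum T g N x) ∧
          (∃ᶠ N : ℕ in atTop, κ x * birkhoffSum T g N x ≤ -(N : ℝ))) ∧
      ∀ x ∉ Y, ∀ a, ∃ l, Tendsto (fun N : ℕ => birkhoffSum T (f a) N x / N) atTop (𝓝 l) := by
  classical
  let P : ι × ℚ × ℕ → X → Prop := fun q x => (0 ≤ q.2.1 ∧ q.2.1 ≤ 1) ∧
    UpperAverageGT T (fun y => f q.1 y - q.2.1) (1 / ((q.2.2 : ℝ) + 1)) x ∧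
    UpperAverageGT T (fun y => q.2.1 - f q.1 y) (1 / ((q.2.2 : ℝ) + 1)) x
  have hP : ∀ q, MeasurableSet {x | P q x} := fun q =>
    (MeasurableSet.const _).inter
      ((measurableSet_upperAverageGT hT ((hf _).sub_const _) _).inter
        (measurableSet_upperAverageGT hT ((hf _).const_sub _) _))
  have hPT : ∀ q x, P q (T x) ↔ P q x := by
    intro q x
    have h1 : ∀ y, |f q.1 y - q.2.1| ≤ 1 + |(q.2.1 : ℝ)| := fun y =>
      (abs_sub _ _).trans (by gcongr; rw [abs_of_nonneg (hf0 _ _)]; exact hf1 _ _)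
    have h2 : ∀ y, |q.2.1 - f q.1 y| ≤ 1 + |(q.2.1 : ℝ)| := fun y => by
      rw [abs_sub_comm]; exact h1 y
    simp only [P, upperAverageGT_apply_iff h1, upperAverageGT_apply_iff h2]
  obtain ⟨e, J, hJ, hJT, hJP⟩ := exists_invariant_selection hP hPT
  refine ⟨{x | ∃ q, P q x}, measurableSet_setOfPred.2 (.exists fun q => measurableSet_setOfPred.1 (hP q)),
    fun x => by simp only [mem_ofPred_eq, hPT], ⟨fun x => (e (J x)).2.2 + 1, ?_, ?_, ?_,
    fun x => if P (e (J x)) x then f (e (J x)).1 x - (e (J x)).2.1 else 0, ?_, ?_, ?_⟩, ?_⟩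
  · exact measurable_select hJ (F := fun n _ => (e n).2.2 + 1) fun n => measurable_const
  · intro x; simp only [hJT]
  · exact fun x => Nat.succ_pos _
  · refine measurable_select hJ (F := fun n x => if P (e n) x then f (e n).1 x - (e n).2.1 else 0) ?_
    intro n
    exact Measurable.ite (hP _) ((hf _).sub_const _) measurable_const
  · intro x
    dsimp only
    split_ifs with h
    · have h1 : (0 : ℝ) ≤ (e (J x)).2.1 := by exact_mod_cast h.1.1
      have h2 : ((e (J x)).2.1 : ℝ) ≤ 1 := by exact_mod_cast h.1.2
      have h3 := hf0 (e (J x)).1 x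
      have h4 := hf1 (e (J x)).1 x
      rw [abs_le]; constructor <;> linarith
    · simp
  · intro x hx
    have hx := hJP x hx
    set q := e (J x) with hq
    have hsum : ∀ N, birkhoffSum T (fun x => if P (e (J x)) x then f (e (J x)).1 x - (e (J x)).2.1
        else 0) N x = birkhoffSum T (fun y => f q.1 y - q.2.1) N x := by
      refine birkhoffSum_congr_orbit fun i => ?_
      have h1 : J (T^[i] x) = J x := invariant_iterate hJT i x
      have h2 : P q (T^[i] x) := by
        have := invariant_iterate (T := T) (M := P q) (fun x => propext (hPT q x)) i x
        rw [this]; exact hx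
      simp only [h1]
      rw [← hq, if_pos h2]
    simp only [hsum]
    have hk : (0 : ℝ) < q.2.2 + 1 := by positivity
    constructor
    · refine hx.2.1.frequently.mono fun N hN => ?_
      rw [div_mul_eq_mul_div, one_mul, div_le_iff₀' hk] at hN
      exact_mod_cast hN
    · refine hx.2.2.frequently.mono fun N hN => ?_
      rw [div_mul_eq_mul_div, one_mul, div_le_iff₀' hk, birkhoffSum_const_sub] at hN
      rw [birkhoffSum_sub_const]
      push_cast
      linarith
  · intro x hx a
    refine exists_tendsto_of_not_oscillating (hf0 a) (hf1 a) fun r k hr0 hr1 h1 h2 => hx ?_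
    exact ⟨(a, r, k), ⟨hr0, hr1⟩, h1, h2⟩

theorem exists_divergent_or_deficient (hT : Measurable T) {c : ℕ → X → ℕ}
    (hc : ∀ i, Measurable (c i))
    (h : ∀ x, ∃ i, ∃ ε : ℝ, 0 < ε ∧ ∀ n, ∃ᶠ N : ℕ in atTop,
      ε * N ≤ birkhoffSum T ({x | n ≤ c i x}.indicator (1 : X → ℝ)) N x) :
    ∃ Y : Set X, MeasurableSet Y ∧ (∀ x, T x ∈ Y ↔ x ∈ Y) ∧
      ∃ κ : X → ℕ, Measurable κ ∧ (∀ x, κ (T x) = κ x) ∧ (∀ x, 0 < κ x) ∧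
        (∃ g : X → ℝ, Measurable g ∧ (∀ x, |g x| ≤ 1) ∧ ∀ x ∈ Y,
          (∃ᶠ N : ℕ in atTop, (N : ℝ) ≤ κ x * birkhoffSum T g N x) ∧
          (∃ᶠ N : ℕ in atTop, κ x * birkhoffSum T g N x ≤ -(N : ℝ))) ∧
        ∃ c : X → ℕ, Measurable c ∧ ∃ d : ℕ → X → ℝ, (∀ n, Measurable (d n)) ∧
          (∀ n x, d n (T x) = d n x) ∧ ∀ x ∉ Y, ∀ n, 1 ≤ κ x * d n x ∧
            Tendsto (fun N : ℕ => birkhoffSum T ({x | n ≤ c x}.indicator (1 : X → ℝ)) N x / N) atTop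
              (𝓝 (d n x)) := by
  classical
  let f : ℕ × ℕ → X → ℝ := fun a => {x | a.2 ≤ c a.1 x}.indicator 1
  have hf : ∀ a, Measurable (f a) := fun a =>
    measurable_one.indicator (measurableSet_le measurable_const (hc _))
  have hf0 : ∀ a x, 0 ≤ f a x := fun a x => indicator_nonneg (f := (1 : X → ℝ)) (fun _ _ => zero_le_one) _
  have hf1 : ∀ a x, f a x ≤ 1 := fun a x => (abs_le.1 (abs_indicator_le_one _ _)).2
  obtain ⟨Y, hY, hYT, ⟨κ, hκ, hκT, hκ0, hdiv⟩, hconv⟩ := exists_divergent_of_oscillating hT hf hf0 hf1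
  let A : ℕ × ℕ → ℕ → X → ℝ := fun a N x => birkhoffSum T (f a) N x / N
  have hA : ∀ a N, Measurable (A a N) := fun a N => (measurable_birkhoffSum hT (hf a) N).div_const _
  let l : ℕ × ℕ → X → ℝ := fun a x => if x ∈ Y then 0 else limsup (fun N => A a N x) atTop
  have hl : ∀ a, Measurable (l a) := fun a =>
    Measurable.ite hY measurable_const (Measurable.limsup fun N => hA a N)
  have hlim : ∀ x ∉ Y, ∀ a, Tendsto (fun N => A a N x) atTop (𝓝 (l a x)) := by
    intro x hx a
    obtain ⟨L, hL⟩ := hconv x hx a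
    simp only [l, if_neg hx]
    rw [hL.limsup_eq]
    exact hL
  have hlT : ∀ a x, l a (T x) = l a x := by
    intro a x
    by_cases hx : x ∈ Y
    · simp only [l, if_pos hx, if_pos ((hYT x).2 hx)]
    · have h1 := hlim x hx a
      have h2 := hlim (T x) (fun h => hx ((hYT x).1 h)) a
      have h3 : Tendsto (fun N => A a N (T x) - A a N x) atTop (𝓝 0) := by
        have h4 : Tendsto (fun N : ℕ => 2 / (N : ℝ)) atTop (𝓝 0) :=
          tendsto_const_nhds.div_atTop tendsto_natCast_atTop_atTop
        refine squeeze_zero_norm (fun N => ?_) h4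
        simp only [A]
        rw [← sub_div, norm_div, Real.norm_natCast]
        gcongr
        have := abs_birkhoffSum_apply_sub_le (T := T) (f := f a) (C := 1) (abs_indicator_le_one _) N x
        simpa using this
      exact sub_eq_zero.1 (tendsto_nhds_unique (h2.sub h1) h3)
  obtain ⟨e, J, hJ, hJT, hJP⟩ := exists_invariant_selection (T := T)
    (P := fun (q : ℕ × ℕ) x => ∀ n, (1 : ℝ) ≤ ((q.2 + 1 : ℕ) : ℝ) * l (q.1, n) x)
    (fun q => measurableSet_setOfPred.2 (.forall fun n => measurableSet_setOfPred.1
      (measurableSet_le measurable_const ((hl _).const_mul _))))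
    (fun q x => by simp only [hlT])
  refine ⟨Y, hY, hYT, fun x => if x ∈ Y then κ x else (e (J x)).2 + 1, ?_, ?_, ?_, ?_,
    fun x => c (e (J x)).1 x, ?_, fun n x => l ((e (J x)).1, n) x, ?_, ?_, ?_⟩
  · exact Measurable.ite hY hκ (measurable_select hJ (F := fun n _ => (e n).2 + 1)
      fun n => measurable_const)
  · intro x; simp only [hYT, hκT, hJT]
  · intro x; dsimp only; split_ifs; exacts [hκ0 x, Nat.succ_pos _]
  · obtain ⟨g, hg, hg1, hgY⟩ := hdiv
    refine ⟨g, hg, hg1, fun x hx => ?_⟩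
    simp only [if_pos hx]
    exact hgY x hx
  · exact measurable_select hJ (F := fun n x => c (e n).1 x) fun n => hc _
  · intro n
    exact measurable_select hJ (F := fun k x => l ((e k).1, n) x) fun k => hl _
  · intro n x; simp only [hJT, hlT]
  · intro x hx n
    simp only [if_neg hx]
    refine ⟨?_, ?_⟩
    · refine hJP x ?_ n
      obtain ⟨i, ε, hε, hi⟩ := h x
      obtain ⟨k, hk⟩ := exists_nat_one_div_lt hε
      refine ⟨(i, k), fun n => ?_⟩
      have h1 : ε ≤ l (i, n) x := by
        by_contra! hlt
        have h2 := (hlim x hx (i, n)).eventually (gt_mem_nhds hlt)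
        obtain ⟨N, hN1, hN2, hN3⟩ := ((hi n).and_eventually (h2.and (eventually_gt_atTop 0))).exists
        have hN3' : (0 : ℝ) < N := by exact_mod_cast hN3
        simp only [A] at hN2
        rw [div_lt_iff₀ hN3'] at hN2
        exact absurd hN1 (not_le.2 hN2)
      have h3 : (0 : ℝ) < (k : ℝ) + 1 := by positivity
      rw [div_lt_iff₀' h3] at hk
      push_cast
      nlinarith
    · refine (hlim x hx ((e (J x)).1, n)).congr fun N => ?_
      simp only [A]
      congr 1
      refine birkhoffSum_congr_orbit (fun i => ?_) _
      have h1 : J (T^[i] x) = J x := invariant_iterate hJT i x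
      simp only [f, indicator, mem_ofPred_eq, h1]
      congr

end Dichotomy

section Counting

variable {X : Type*} {T : Equiv.Perm X}

theorem birkhoffSum_mono {f : X → X} {u v : X → ℕ} {x : X}
    (h : ∀ i : ℕ, u (f^[i] x) ≤ v (f^[i] x)) (N : ℕ) :
    birkhoffSum f u N x ≤ birkhoffSum f v N x :=
  Finset.sum_le_sum fun i _ => h i

theorem birkhoffSum_le_of_le_one {f : X → X} {u : X → ℕ} (hu : ∀ x, u x ≤ 1) (N : ℕ) (x : X) :
    birkhoffSum f u N x ≤ N := by
  calc birkhoffSum f u N x ≤ ∑ i ∈ Finset.range N, 1 := Finset.sum_le_sum fun i _ => hu _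
    _ = N := by simp

theorem birkhoffSum_iterate_le {f : X → X} {u : X → ℕ} (hu : ∀ x, u x ≤ 1) (N j : ℕ) (x : X) :
    birkhoffSum f u N (f^[j] x) ≤ birkhoffSum f u N x + j ∧
      birkhoffSum f u N x ≤ birkhoffSum f u N (f^[j] x) + j := by
  have h1 := birkhoffSum_add f u j N x
  have h2 := birkhoffSum_add f u N j x
  have h3 := birkhoffSum_le_of_le_one (f := f) hu j x
  have h4 := birkhoffSum_le_of_le_one (f := f) hu j (f^[N] x)
  rw [add_comm j N] at h1
  omega

theorem birkhoffSum_birkhoffSum {f : X → X} (u : X → ℕ) (N L : ℕ) (x : X) :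
    birkhoffSum f (birkhoffSum f u L) N x = ∑ j ∈ Finset.range L, birkhoffSum f u N (f^[j] x) := by
  simp only [birkhoffSum]
  rw [Finset.sum_comm]
  refine Finset.sum_congr rfl fun i _ => Finset.sum_congr rfl fun j _ => ?_
  rw [← iterate_add_apply, ← iterate_add_apply, add_comm]

theorem mul_birkhoffSum_le {f : X → X} {u : X → ℕ} (hu : ∀ x, u x ≤ 1) (N L : ℕ) (x : X) :
    L * birkhoffSum f u N x ≤ birkhoffSum f (birkhoffSum f u L) N x + L * L := by
  rw [birkhoffSum_birkhoffSum]
  calc L * birkhoffSum f u N x = ∑ j ∈ Finset.range L, birkhoffSum f u N x := by simp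
    _ ≤ ∑ j ∈ Finset.range L, (birkhoffSum f u N (f^[j] x) + L) := by
        refine Finset.sum_le_sum fun j hj => ?_
        have := (birkhoffSum_iterate_le (f := f) hu N j x).2
        have := Finset.mem_range.1 hj
        omega
    _ = _ := by simp [Finset.sum_add_distrib]

theorem birkhoffSum_birkhoffSum_le {f : X → X} {u : X → ℕ} (hu : ∀ x, u x ≤ 1) (N L : ℕ) (x : X) :
    birkhoffSum f (birkhoffSum f u L) N x ≤ L * birkhoffSum f u N x + L * L := by
  rw [birkhoffSum_birkhoffSum]
  calc _ ≤ ∑ j ∈ Finset.range L, (birkhoffSum f u N x + L) := by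
        refine Finset.sum_le_sum fun j hj => ?_
        have := (birkhoffSum_iterate_le (f := f) hu N j x).1
        have := Finset.mem_range.1 hj
        omega
    _ = _ := by simp [mul_add]

theorem indicator_one_le_one (S : Set X) (x : X) : S.indicator (1 : X → ℕ) x ≤ 1 := by
  by_cases h : x ∈ S <;> simp [h]

theorem birkhoffSum_natCast {f : X → X} (u : X → ℕ) (N : ℕ) (x : X) :
    birkhoffSum f (fun y => (u y : ℝ)) N x = (birkhoffSum f u N x : ℕ) := by
  simp [birkhoffSum]

theorem birkhoffSum_indicator_cast {f : X → X} (S : Set X) (N : ℕ) (x : X) :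
    birkhoffSum f (S.indicator (1 : X → ℝ)) N x = (birkhoffSum f (S.indicator (1 : X → ℕ)) N x : ℕ) := by
  rw [← birkhoffSum_natCast]
  congr 1
  ext y
  by_cases h : y ∈ S <;> simp [h]

theorem birkhoffSum_indicator_le_one_of_discrete {M : X → ℕ} (hMT : ∀ x, M (T x) = M x) {B : Set X}
    (hB : Discrete T M B) (x : X) : birkhoffSum T (B.indicator (1 : X → ℕ)) (M x) x ≤ 1 := by
  classical
  simp only [birkhoffSum, indicator_apply, Pi.one_apply]
  rw [← Finset.card_filter, Finset.card_le_one]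
  intro a ha b hb
  simp only [Finset.mem_filter, Finset.mem_range] at ha hb
  by_contra hne
  refine hB _ ha.2 ((b : ℤ) - a) (by omega) ?_ ?_
  · rw [invariant_iterate hMT, abs_lt]; omega
  · have : (T ^ ((b : ℤ) - a)) (T^[a] x) = T^[b] x := by
      rw [Equiv.Perm.iterate_eq_pow, Equiv.Perm.iterate_eq_pow, ← zpow_natCast, ← zpow_natCast,
        ← zpow_add_apply]
      simp
    rw [this]; exact hb.2

theorem mul_birkhoffSum_indicator_le_of_discrete {M : X → ℕ} (hMT : ∀ x, M (T x) = M x) {B : Set X}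
    (hB : Discrete T M B) (N : ℕ) (x : X) :
    M x * birkhoffSum T (B.indicator (1 : X → ℕ)) N x ≤ N + M x * M x := by
  refine (mul_birkhoffSum_le (indicator_one_le_one B) N (M x) x).trans ?_
  gcongr
  calc _ ≤ ∑ i ∈ Finset.range N, 1 := Finset.sum_le_sum fun i _ => by
        have := birkhoffSum_indicator_le_one_of_discrete hMT hB (T^[i] x)
        rwa [invariant_iterate hMT] at this
    _ = N := by simp

theorem le_mul_birkhoffSum_indicator {B : Set X} {L : ℕ} {x : X}
    (h : ∀ i : ℕ, ∃ j < L, T^[j] (T^[i] x) ∈ B) (N : ℕ) :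
    N ≤ L * birkhoffSum T (B.indicator (1 : X → ℕ)) N x + L * L := by
  refine le_trans ?_ (birkhoffSum_birkhoffSum_le (indicator_one_le_one B) N L x)
  calc N = ∑ i ∈ Finset.range N, 1 := by simp
    _ ≤ _ := Finset.sum_le_sum fun i _ => by
      obtain ⟨j, hj, hjB⟩ := h i
      calc 1 = B.indicator (1 : X → ℕ) (T^[j] (T^[i] x)) := by simp [hjB]
        _ ≤ birkhoffSum T (B.indicator (1 : X → ℕ)) L (T^[i] x) :=
          Finset.single_le_sum (f := fun k => B.indicator (1 : X → ℕ) (T^[k] (T^[i] x)))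
            (fun _ _ => Nat.zero_le _) (Finset.mem_range.2 hj)

end Counting

section Hitting

variable {X : Type*} {T : Equiv.Perm X}

/-- The first time, possibly zero, at which the orbit of `x` meets `B`. -/
noncomputable def hit (T : Equiv.Perm X) (B : Set X) (x : X) : ℕ := sInf {n | T^[n] x ∈ B}

theorem measurable_hit {m : MeasurableSpace X} (hT : IsAuto T m) {B : Set X} (hB : MeasurableSet B) :
    Measurable (hit T B) :=
  measurable_sInf_nat fun n => hT.iterate n hB

theorem iterate_hit_mem {B : Set X} {x : X} (h : ∃ n : ℕ, T^[n] x ∈ B) : T^[hit T B x] x ∈ B :=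
  Nat.sInf_mem (s := {n | T^[n] x ∈ B}) h

theorem hit_le {B : Set X} {x : X} {n : ℕ} (h : T^[n] x ∈ B) : hit T B x ≤ n := Nat.sInf_le h

theorem hit_eq_zero {B : Set X} {x : X} (h : x ∈ B) : hit T B x = 0 :=
  Nat.eq_zero_of_le_zero (hit_le (n := 0) h)

theorem hit_eq_succ {B : Set X} {x : X} (hx : x ∉ B) (h : ∃ n : ℕ, T^[n] x ∈ B) :
    hit T B x = hit T B (T x) + 1 := by
  have h1 := iterate_hit_mem h
  obtain ⟨k, hk⟩ : ∃ k, hit T B x = k + 1 :=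
    Nat.exists_eq_succ_of_ne_zero fun h0 => hx (by rw [h0] at h1; exact h1)
  rw [hk, iterate_succ_apply] at h1
  have h2 := hit_le h1
  have h3 : T^[hit T B (T x) + 1] x ∈ B := iterate_hit_mem (x := T x) ⟨k, h1⟩
  have h4 := hit_le h3
  omega

/-- Bounded gaps in both directions yield forward visits. -/
theorem exists_iterate_mem_of_near {M : X → ℕ} (hMT : ∀ x, M (T x) = M x) {B : Set X}
    (h : ∀ x, ∃ i : ℤ, |i| < M x ∧ (T ^ i) x ∈ B) (x : X) : ∃ j < 2 * M x, T^[j] x ∈ B := by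
  obtain ⟨i, hi, hiB⟩ := h (T^[M x] x)
  rw [invariant_iterate hMT, abs_lt] at hi
  refine ⟨((M x : ℤ) + i).toNat, by omega, ?_⟩
  rw [Equiv.Perm.iterate_eq_pow, ← zpow_natCast, ← zpow_add_apply] at hiB
  rw [Equiv.Perm.iterate_eq_pow, ← zpow_natCast, Int.toNat_of_nonneg (by omega), add_comm]
  exact hiB

theorem hit_lt {M : X → ℕ} (hMT : ∀ x, M (T x) = M x) {B : Set X}
    (h : ∀ x, ∃ i : ℤ, |i| < M x ∧ (T ^ i) x ∈ B) (x : X) : hit T B x < 2 * M x := by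
  obtain ⟨j, hj, hjB⟩ := exists_iterate_mem_of_near hMT h x
  exact (hit_le hjB).trans_lt hj

theorem measurable_of_measurableSet_lt {m : MeasurableSpace X} {f : X → ℕ}
    (h : ∀ j, MeasurableSet {x | j < f x}) : Measurable f :=
  measurable_of_Ioi h

end Hitting

section Divergent

variable {X : Type*} {T : Equiv.Perm X}

theorem exists_pushed_cocycle {m : MeasurableSpace X} (hT : IsAuto T m) {M : X → ℕ}
    (hMT : ∀ x, M (T x) = M x) {B : Set X} (hB : MeasurableSet B)
    (hnear : ∀ x, ∃ i : ℤ, |i| < M x ∧ (T ^ i) x ∈ B) {g : X → ℝ} (hg : Measurable g)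
    (hg1 : ∀ x, |g x| ≤ 1) :
    ∃ F : X → ℝ, Measurable F ∧ (∀ x ∉ B, F x = 0) ∧ (∀ x, |F x| ≤ 2 * M x + 1) ∧
      ∀ N x, |birkhoffSum T F N x - birkhoffSum T g N x| ≤ 4 * M x := by
  have hex : ∀ x, ∃ n : ℕ, T^[n] x ∈ B := fun x => by
    obtain ⟨j, _, hj⟩ := exists_iterate_mem_of_near hMT hnear x
    exact ⟨j, hj⟩
  set G : X → ℝ := fun x => birkhoffSum T g (hit T B x) x with hG
  have hGm : Measurable G := by
    have : Measurable fun q : ℕ × X => birkhoffSum T g q.1 q.2 :=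
      measurable_from_prod_countable_right fun n => measurable_birkhoffSum hT.1 hg n
    exact this.comp ((measurable_hit hT hB).prodMk measurable_id)
  have hGb : ∀ x, |G x| ≤ 2 * M x := by
    intro x
    calc |G x| ≤ ∑ i ∈ Finset.range (hit T B x), |g (T^[i] x)| := Finset.abs_sum_le_sum_abs _ _
      _ ≤ ∑ i ∈ Finset.range (hit T B x), (1 : ℝ) := Finset.sum_le_sum fun i _ => hg1 _
      _ = hit T B x := by simp
      _ ≤ (2 * M x : ℕ) := by exact_mod_cast (hit_lt hMT hnear x).le
      _ = 2 * M x := by push_cast; ring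
  have hG0 : ∀ x ∈ B, G x = 0 := fun x hx => by simp [hG, hit_eq_zero hx]
  refine ⟨fun x => g x + G (T x) - G x, (hg.add (hGm.comp hT.1)).sub hGm, fun x hx => ?_,
    fun x => ?_, fun N x => ?_⟩
  · have : G x = g x + G (T x) := by
      simp only [hG]
      rw [hit_eq_succ hx (hex x), birkhoffSum_succ']
    linarith
  · dsimp only
    by_cases hx : x ∈ B
    · rw [hG0 x hx, sub_zero]
      refine (abs_add_le _ _).trans ?_
      have := hGb (T x)
      rw [hMT] at this
      linarith [hg1 x]
    · have : G x = g x + G (T x) := by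
        simp only [hG]
        rw [hit_eq_succ hx (hex x), birkhoffSum_succ']
      rw [this, sub_self, abs_zero]
      positivity
  · have h1 : birkhoffSum T (fun x => g x + G (T x) - G x) N x
        = birkhoffSum T g N x + (G (T^[N] x) - G x) := by
      induction N with
      | zero => simp
      | succ n ih => rw [birkhoffSum_succ, birkhoffSum_succ, ih, iterate_succ_apply']; ring
    rw [h1, add_sub_cancel_left]
    refine (abs_sub _ _).trans ?_
    have := hGb (T^[N] x)
    rw [invariant_iterate hMT] at this
    linarith [hGb x]

theorem natCast_birkhoffSum_toNat_sub {f : X → X} (a : X → ℤ) (N : ℕ) (x : X) :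
    ((birkhoffSum f (fun y => (a y).toNat) N x : ℕ) : ℤ)
      - (birkhoffSum f (fun y => (-a y).toNat) N x : ℕ) = birkhoffSum f a N x := by
  simp only [birkhoffSum, Nat.cast_sum, ← Finset.sum_sub_distrib]
  exact Finset.sum_congr rfl fun i _ => by omega

/-- An integer-valued function supported on the marker set whose Birkhoff sums take both signs,
with a definite margin on the positive side. -/
theorem exists_oscillating_marker_function {m : MeasurableSpace X} (hT : IsAuto T m) {M κ : X → ℕ}
    (hM : Measurable M) (hMT : ∀ x, M (T x) = M x) (hκ : Measurable κ) (hκT : ∀ x, κ (T x) = κ x)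
    (hκ0 : ∀ x, 0 < κ x) {B : Set X} (hB : MeasurableSet B) (hdisc : Discrete T M B)
    (hnear : ∀ x, ∃ i : ℤ, |i| < M x ∧ (T ^ i) x ∈ B) {Y : Set X} (hY : MeasurableSet Y)
    (hYT : ∀ x, T x ∈ Y ↔ x ∈ Y) {g : X → ℝ} (hg : Measurable g) (hg1 : ∀ x, |g x| ≤ 1)
    (hosc : ∀ x ∈ Y, (∃ᶠ N : ℕ in atTop, (N : ℝ) ≤ κ x * birkhoffSum T g N x) ∧
      (∃ᶠ N : ℕ in atTop, κ x * birkhoffSum T g N x ≤ -(N : ℝ))) :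
    ∃ a : X → ℤ, Measurable a ∧ (∀ x ∉ B ∩ Y, a x = 0) ∧ (∀ x, |a x| ≤ 9 * κ x + 1) ∧
      ∀ x ∈ Y, (∃ N, 0 < N ∧ birkhoffSum T a N x ≤ 0) ∧
        ∃ N, 0 < N ∧ ((birkhoffSum T ((B ∩ Y).indicator (1 : X → ℕ)) N x : ℕ) : ℤ)
          ≤ birkhoffSum T a N x := by
  classical
  obtain ⟨F, hF, hF0, hFb, hFs⟩ := exists_pushed_cocycle hT hMT hB hnear hg hg1
  have hMpos : ∀ x, 1 ≤ M x := fun x => by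
    obtain ⟨i, hi, _⟩ := hnear x
    have := abs_nonneg i
    omega
  have hMr : ∀ x, (1 : ℝ) ≤ M x := fun x => by exact_mod_cast hMpos x
  have hκr : ∀ x, (1 : ℝ) ≤ κ x := fun x => by exact_mod_cast hκ0 x
  set b : X → ℝ := fun x => 3 * κ x / M x * F x with hb
  have hbm : Measurable b :=
    ((measurable_const.mul (measurable_from_nat.comp hκ)).div (measurable_from_nat.comp hM)).mul hF
  have hsum : ∀ N x, birkhoffSum T b N x = 3 * κ x / M x * birkhoffSum T F N x := by
    intro N x
    simp only [birkhoffSum, hb, Finset.mul_sum]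
    exact Finset.sum_congr rfl fun i _ => by rw [invariant_iterate hMT, invariant_iterate hκT]
  have hY' : ∀ x ∈ Y, ∀ i : ℕ, T^[i] x ∈ Y := fun x hx i => (mem_iterate_of_invariant hYT i x).2 hx
  refine ⟨fun x => if x ∈ Y then ⌊b x⌋ else 0, Measurable.ite hY hbm.floor measurable_const,
    fun x hx => ?_, fun x => ?_, fun x hx => ⟨?_, ?_⟩⟩
  · dsimp only
    split_ifs with hxY
    · have : F x = 0 := hF0 x fun hxB => hx ⟨hxB, hxY⟩
      simp [hb, this]
    · rfl
  · have h1 : |b x| ≤ 9 * κ x := by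
      have : |b x| = 3 * κ x / M x * |F x| := by
        rw [hb, abs_mul, abs_of_nonneg (by positivity)]
      rw [this, div_mul_eq_mul_div, div_le_iff₀ (by linarith [hMr x])]
      nlinarith [hFb x, hMr x, hκr x]
    dsimp only
    split_ifs
    · have h2 := abs_le.1 h1
      have h3 : (-(9 * κ x + 1 : ℤ)) ≤ ⌊b x⌋ := by
        rw [Int.le_floor]; push_cast; linarith
      have h4 : ⌊b x⌋ ≤ (9 * κ x + 1 : ℤ) := by
        have h5 : (⌊b x⌋ : ℝ) ≤ (9 * κ x + 1 : ℤ) := by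
          push_cast; linarith [Int.floor_le (b x)]
        exact_mod_cast h5
      exact abs_le.2 ⟨h3, h4⟩
    · simp; positivity
  · obtain ⟨N, hN1, hN2⟩ := ((hosc x hx).2.and_eventually
      (eventually_ge_atTop (4 * M x * κ x + 1))).exists
    refine ⟨N, by omega, ?_⟩
    have h1 : ((birkhoffSum T (fun x => if x ∈ Y then ⌊b x⌋ else 0) N x : ℤ) : ℝ)
        ≤ birkhoffSum T b N x := by
      simp only [birkhoffSum, Int.cast_sum]
      exact Finset.sum_le_sum fun i _ => by rw [if_pos (hY' x hx i)]; exact Int.floor_le _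
    have h2 := (abs_le.1 (hFs N x)).2
    have h3 : ((4 * M x * κ x + 1 : ℕ) : ℝ) ≤ N := by exact_mod_cast hN2
    push_cast at h3
    have h4 : birkhoffSum T F N x ≤ 0 := by
      by_contra! hpos
      nlinarith [hκr x]
    have h5 : birkhoffSum T b N x ≤ 0 := by
      rw [hsum]
      exact mul_nonpos_of_nonneg_of_nonpos (by positivity) h4
    exact_mod_cast h1.trans h5
  · obtain ⟨N, hN1, hN2⟩ := ((hosc x hx).1.and_eventually
      (eventually_ge_atTop (12 * κ x * M x + 2 * (M x * M x) + 1))).exists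
    refine ⟨N, by omega, ?_⟩
    set s := birkhoffSum T (B.indicator (1 : X → ℕ)) N x with hs
    have hind : birkhoffSum T ((B ∩ Y).indicator (1 : X → ℕ)) N x ≤ s :=
      birkhoffSum_mono (fun i => indicator_le_indicator_of_subset inter_subset_left
        (fun _ => Nat.zero_le _) _) N
    have h0 : birkhoffSum T b N x - s ≤
        ((birkhoffSum T (fun x => if x ∈ Y then ⌊b x⌋ else 0) N x : ℤ) : ℝ) := by
      simp only [hs, birkhoffSum, Int.cast_sum, Nat.cast_sum, ← Finset.sum_sub_distrib]
      refine Finset.sum_le_sum fun i _ => ?_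
      rw [if_pos (hY' x hx i)]
      by_cases hiB : T^[i] x ∈ B
      · simp only [indicator_of_mem hiB, Pi.one_apply, Nat.cast_one]
        linarith [Int.lt_floor_add_one (b (T^[i] x))]
      · simp [indicator_of_notMem hiB, hb, hF0 _ hiB]
    have h2 := (abs_le.1 (hFs N x)).1
    have h3 : ((12 * κ x * M x + 2 * (M x * M x) + 1 : ℕ) : ℝ) ≤ N := by exact_mod_cast hN2
    push_cast at h3
    have h4 : (M x : ℝ) * s ≤ N + M x * M x := by
      exact_mod_cast mul_birkhoffSum_indicator_le_of_discrete hMT hdisc N x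
    have h5 : 2 * (s : ℝ) ≤ birkhoffSum T b N x := by
      rw [hsum, div_mul_eq_mul_div, le_div_iff₀ (by linarith [hMr x])]
      nlinarith [hκr x, hMr x]
    have h6 : (s : ℝ) ≤ ((birkhoffSum T (fun x => if x ∈ Y then ⌊b x⌋ else 0) N x : ℤ) : ℝ) := by
      linarith
    have h7 : (s : ℤ) ≤ birkhoffSum T (fun x => if x ∈ Y then ⌊b x⌋ else 0) N x := by
      exact_mod_cast h6
    exact le_trans (by exact_mod_cast hind) h7

/-- The code `D` recovers the trace on `B ∩ Y` of the ambient measurable structure. -/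
def IsCode [mX : MeasurableSpace X] (T : Equiv.Perm X) (B Y : Set X) (D : ℕ → Set X) : Prop :=
  ∀ m : MeasurableSpace X, IsAuto T m → MeasurableSet[m] B → MeasurableSet[m] Y →
    (∀ j, MeasurableSet[m] (D j)) → ∀ E, MeasurableSet[mX] E → MeasurableSet[m] (E ∩ (B ∩ Y))

theorem exists_code_of_divergent [mX : MeasurableSpace X] [StandardBorelSpace X]
    (hT : IsAuto T mX) {M κ : X → ℕ}
    (hM : Measurable M) (hMT : ∀ x, M (T x) = M x) (hκ : Measurable κ) (hκT : ∀ x, κ (T x) = κ x)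
    (hκ0 : ∀ x, 0 < κ x) (hMκ : ∀ x, 200 * κ x ≤ M x)
    {B : Set X} (hB : MeasurableSet B) (hdisc : Discrete T M B)
    (hnear : ∀ x, ∃ i : ℤ, |i| < M x ∧ (T ^ i) x ∈ B) {Y : Set X} (hY : MeasurableSet Y)
    (hYT : ∀ x, T x ∈ Y ↔ x ∈ Y) {g : X → ℝ} (hg : Measurable g) (hg1 : ∀ x, |g x| ≤ 1)
    (hosc : ∀ x ∈ Y, (∃ᶠ N : ℕ in atTop, (N : ℝ) ≤ κ x * birkhoffSum T g N x) ∧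
      (∃ᶠ N : ℕ in atTop, κ x * birkhoffSum T g N x ≤ -(N : ℝ))) :
    ∃ D : ℕ → Set X, (∀ j, MeasurableSet (D j)) ∧ (∀ j, D j ⊆ B ∩ Y) ∧
      (∀ j, ∀ b ∈ D j, 4 * j + 9 ≤ M b) ∧ IsCode T B Y D := by
  obtain ⟨a, ha, ha0, hab, hosc'⟩ := exists_oscillating_marker_function hT hM hMT hκ hκT hκ0 hB hdisc
    hnear hY hYT hg hg1 hosc
  set p : X → ℕ := fun x => (a x).toNat with hp
  set n : X → ℕ := fun x => (-a x).toNat with hn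
  set e : X → ℕ := (B ∩ Y).indicator 1 with he
  have hpm : Measurable p := (measurable_from_top (f := Int.toNat)).comp ha
  have hnm : Measurable n := (measurable_from_top (f := fun z : ℤ => (-z).toNat)).comp ha
  have hpn : ∀ N x, ((birkhoffSum T p N x : ℕ) : ℤ) - (birkhoffSum T n N x : ℕ)
      = birkhoffSum T a N x := natCast_birkhoffSum_toNat_sub a
  have hmem : ∀ x, x ∉ Y → a x = 0 ∧ e x = 0 := fun x hx =>
    ⟨ha0 x fun h => hx h.2, indicator_of_notMem (fun h => hx h.2) _⟩
  have h1 : ∀ x, 0 < (n + e) x → ∃ N, 0 < N ∧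
      birkhoffSum T (n + e) N x ≤ birkhoffSum T p N x := by
    intro x hx
    have hxY : x ∈ Y := by
      by_contra h
      simp [hn, hmem x h] at hx
    obtain ⟨N, hN, hle⟩ := (hosc' x hxY).2
    refine ⟨N, hN, ?_⟩
    rw [show birkhoffSum T (n + e) N x = birkhoffSum T n N x + birkhoffSum T e N x from
      Finset.sum_add_distrib]
    have := hpn N x
    omega
  have h2 : ∀ x, 0 < p x → ∃ N, 0 < N ∧ birkhoffSum T p N x ≤ birkhoffSum T n N x := by
    intro x hx
    have hxY : x ∈ Y := by
      by_contra h
      simp [hp, hmem x h] at hx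
    obtain ⟨N, hN, hle⟩ := (hosc' x hxY).1
    refine ⟨N, hN, ?_⟩
    have := hpn N x
    omega
  set ψ : X × ℕ → X × ℕ := serve T p n ∘ serve T (n + e) p with hψ
  have hmaps : MapsTo ψ (cells (n + e)) (cells n) := (mapsTo_serve h2).comp (mapsTo_serve h1)
  have hinj : InjOn ψ (cells (n + e)) :=
    (injOn_serve T.injective).comp (injOn_serve T.injective) (mapsTo_serve h1)
  have hψm : ∀ m : MeasurableSpace X, IsAuto T m → MeasurableSet[m] (B ∩ Y) → Measurable[m] p →
      Measurable[m] n → Measurable[m.prod ⊤, m.prod ⊤] (absorb n ψ) := by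
    intro m hTm hBY hpm hnm
    have hem : Measurable[m] e := measurable_one.indicator hBY
    exact measurable_absorb hnm
      ((measurable_serve hTm.1 hpm hnm).comp (measurable_serve hTm.1 (hnm.add hem) hpm))
  have hset : {q : X × ℕ | 0 < e q.1} = {q | q.1 ∈ B ∩ Y} := by
    ext q
    by_cases hq : q.1 ∈ B ∩ Y
    · simp only [he, mem_ofPred_eq, indicator_of_mem hq, Pi.one_apply, zero_lt_one, hq]
    · simp only [he, mem_ofPred_eq, indicator_of_notMem hq, lt_irrefl, hq]
  obtain ⟨hai, ham⟩ := absorb_spec hinj hmaps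
  rw [hset] at hai ham
  obtain ⟨D, hD, hDn, hcode⟩ := exists_storage (hB.inter hY)
    (hψm mX hT (hB.inter hY) hpm hnm) hai ham
  let C : ℕ → ℕ → Set X := fun i j => if i = 0 then {x | j < p x} else
    if i = 1 then {x | j < n x} else D j
  have hCm : ∀ i j, MeasurableSet (C i j) := by
    intro i j
    simp only [C]
    split_ifs
    exacts [measurableSet_lt measurable_const hpm, measurableSet_lt measurable_const hnm, hD j]
  have hCj : ∀ i j, ∀ x ∈ C i j, a x ≠ 0 ∧ j < 9 * κ x + 1 := by
    intro i j x hx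
    have h3 := abs_le.1 (hab x)
    have h4 : j < p x ∨ j < n x := by
      simp only [C] at hx
      split_ifs at hx
      exacts [Or.inl hx, Or.inr hx, Or.inr (hDn j x hx)]
    simp only [hp, hn] at h4
    omega
  refine ⟨fun j => C (j % 3) (j / 3), fun j => hCm _ _, fun j x hx => ?_, fun j x hx => ?_, ?_⟩
  · by_contra h
    exact (hCj _ _ x hx).1 (ha0 x h)
  · have := (hCj _ _ x hx).2
    have := hMκ x
    have := hκ0 x
    omega
  · intro m hTm hBm hYm hDm
    have hC : ∀ i < 3, ∀ j, MeasurableSet[m] (C i j) := by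
      intro i hi j
      have := hDm (3 * j + i)
      dsimp only at this
      rwa [show (3 * j + i) % 3 = i by omega, show (3 * j + i) / 3 = j by omega] at this
    have hp' : Measurable[m] p := measurable_of_measurableSet_lt fun j => hC 0 (by omega) j
    have hn' : Measurable[m] n := measurable_of_measurableSet_lt fun j => hC 1 (by omega) j
    exact hcode m (hBm.inter hYm) (hψm m hTm (hBm.inter hYm) hp' hn') fun j => hC 2 (by omega) j

end Divergent

section SparseCode

variable {X : Type*} {T : Equiv.Perm X} {L : X → ℕ} {Y R P : Set X}

theorem mul_birkhoffSum_add_le_of_sparse (hLT : ∀ x, L (T x) = L x) (hYT : ∀ x, T x ∈ Y ↔ x ∈ Y)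
    (hhit : ∀ x ∈ Y, ∃ j < L x, T^[j] x ∈ R)
    (hsparse : ∀ x ∈ Y, ∀ᶠ N : ℕ in atTop,
      2 * L x ^ 3 * birkhoffSum T (P.indicator (1 : X → ℕ)) N x ≤ N) {x : X} (hx : x ∈ Y) :
    ∃ N, 0 < N ∧ L x ^ 2 * birkhoffSum T (P.indicator (1 : X → ℕ)) N x + L x ^ 3
      ≤ birkhoffSum T (R.indicator (1 : X → ℕ)) N x := by
  obtain ⟨N, h1, h2⟩ := ((hsparse x hx).and
    (eventually_ge_atTop (2 * (L x ^ 4 + L x ^ 2) + 1))).exists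
  refine ⟨N, by omega, ?_⟩
  have h3 : N ≤ L x * birkhoffSum T (R.indicator (1 : X → ℕ)) N x + L x * L x := by
    refine le_mul_birkhoffSum_indicator (fun i => ?_) N
    obtain ⟨j, hj, hjR⟩ := hhit (T^[i] x) ((mem_iterate_of_invariant hYT i x).2 hx)
    rw [invariant_iterate hLT] at hj
    exact ⟨j, hj, hjR⟩
  have hL : 0 < L x := by
    obtain ⟨j, hj, _⟩ := hhit x hx
    omega
  generalize birkhoffSum T (P.indicator (1 : X → ℕ)) N x = s at *
  generalize birkhoffSum T (R.indicator (1 : X → ℕ)) N x = r at *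
  refine le_of_mul_le_mul_left (a := L x) ?_ hL
  nlinarith

theorem exists_birkhoffSum_le_of_sparse (hLT : ∀ x, L (T x) = L x) (hYT : ∀ x, T x ∈ Y ↔ x ∈ Y)
    (hhit : ∀ x ∈ Y, ∃ j < L x, T^[j] x ∈ R)
    (hsparse : ∀ x ∈ Y, ∀ᶠ N : ℕ in atTop,
      2 * L x ^ 3 * birkhoffSum T (P.indicator (1 : X → ℕ)) N x ≤ N) {x : X} (hx : x ∈ Y) :
    ∃ N, 0 < N ∧ birkhoffSum T (P.indicator (1 : X → ℕ)) N x
      ≤ birkhoffSum T (R.indicator (1 : X → ℕ)) N x := by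
  obtain ⟨N, hN, h⟩ := mul_birkhoffSum_add_le_of_sparse hLT hYT hhit hsparse hx
  have hL : 0 < L x := by
    obtain ⟨j, hj, _⟩ := hhit x hx
    omega
  refine ⟨N, hN, le_trans ?_ h⟩
  have : 1 ≤ L x ^ 2 := Nat.one_le_pow _ _ hL
  nlinarith

/-- Every point of `Y` is reached from a point of `R` before the next visit to `R`. -/
theorem exists_previous_visit (hLT : ∀ x, L (T x) = L x) (hYT : ∀ x, T x ∈ Y ↔ x ∈ Y)
    (hhit : ∀ x ∈ Y, ∃ j < L x, T^[j] x ∈ R) {x : X} (hx : x ∈ Y) :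
    ∃ b ∈ R, ∃ i < hit T R (T b) + 1, T^[i] b = x := by
  classical
  set z : X := (T ^ (-(L x : ℤ))) x with hz
  have hzL : T^[L x] z = x := by
    rw [Equiv.Perm.iterate_eq_pow, ← zpow_natCast, hz, ← zpow_add_apply]
    simp
  have hLz : L z = L x := invariant_zpow hLT _ x
  have hzY : z ∈ Y := (mem_zpow_of_invariant hYT _ x).2 hx
  obtain ⟨j, hj, hjR⟩ := hhit z hzY
  rw [hLz] at hj
  set n := Nat.findGreatest (fun j => T^[j] z ∈ R) (L x) with hn
  have hnR : T^[n] z ∈ R := Nat.findGreatest_spec (P := fun j => T^[j] z ∈ R) hj.le hjR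
  have hnL : n ≤ L x := Nat.findGreatest_le _
  refine ⟨T^[n] z, hnR, L x - n, ?_, ?_⟩
  · by_contra! hle
    have hbY : T (T^[n] z) ∈ Y := (hYT _).2 ((mem_iterate_of_invariant hYT n z).2 hzY)
    obtain ⟨j', _, hj'⟩ := hhit _ hbY
    have h1 := iterate_hit_mem (T := T) ⟨j', hj'⟩
    set h := hit T R (T (T^[n] z))
    have h2 : T^[h + 1 + n] z ∈ R := by
      rwa [iterate_add_apply, iterate_succ_apply]
    have h3 := Nat.le_findGreatest (P := fun j => T^[j] z ∈ R) (n := L x) (m := h + 1 + n)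
      (by omega) h2
    omega
  · rw [← iterate_add_apply, Nat.sub_add_cancel hnL, hzL]

/-- A sparse set can be encoded by two subsets of a syndetic set. -/
theorem exists_code_of_sparse [mX : MeasurableSpace X] [StandardBorelSpace X] (hT : IsAuto T mX)
    (hLT : ∀ x, L (T x) = L x) (hYT : ∀ x, T x ∈ Y ↔ x ∈ Y) (hRm : MeasurableSet R)
    (hRY : R ⊆ Y) (hPm : MeasurableSet P) (hPY : P ⊆ Y)
    (hhit : ∀ x ∈ Y, ∃ j < L x, T^[j] x ∈ R)
    (hsparse : ∀ x ∈ Y, ∀ᶠ N : ℕ in atTop,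
      2 * L x ^ 3 * birkhoffSum T (P.indicator (1 : X → ℕ)) N x ≤ N) :
    ∃ Z V : Set X, MeasurableSet Z ∧ MeasurableSet V ∧ Z ⊆ R ∧ V ⊆ R ∧
      ∀ m : MeasurableSpace X, IsAuto T m → MeasurableSet[m] R → MeasurableSet[m] Z →
        MeasurableSet[m] V → MeasurableSet[m] P := by
  classical
  set γ : X → ℕ := fun b => hit T R (T b) + 1 with hγ
  have hγm : ∀ m : MeasurableSpace X, IsAuto T m → MeasurableSet[m] R → Measurable[m] γ :=
    fun m hTm hR => ((measurable_hit hTm hR).comp hTm.1).add_const 1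
  have hγL : ∀ b ∈ Y, γ b ≤ L b := by
    intro b hb
    obtain ⟨j, hj, hjR⟩ := hhit (T b) ((hYT b).2 hb)
    have := hit_le hjR
    rw [hLT] at hj
    simp only [hγ]
    omega
  set Z : Set X := {b | b ∈ R ∧ ∃ i, i < γ b ∧ T^[i] b ∈ P} with hZ
  have hZm : MeasurableSet Z := by
    refine measurableSet_setOfPred.2 (hRm.mem.and (.exists fun i => ?_))
    exact (measurableSet_setOfPred.1 (measurableSet_lt measurable_const (hγm mX hT hRm))).and
      (measurableSet_setOfPred.1 (hT.iterate i hPm))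
  set u : X → ℕ := Z.indicator γ with hu
  set v : X → ℕ := R.indicator 1 with hv
  have hum : ∀ m : MeasurableSpace X, IsAuto T m → MeasurableSet[m] R → MeasurableSet[m] Z →
      Measurable[m] u := fun m hTm hR hZ => (hγm m hTm hR).indicator hZ
  have hvm : ∀ m : MeasurableSpace X, MeasurableSet[m] R → Measurable[m] v :=
    fun m hR => measurable_one.indicator hR
  have hle : ∀ x, 0 < u x → ∃ N, 0 < N ∧ birkhoffSum T u N x ≤ birkhoffSum T v N x := by
    intro x hux
    have hxZ : x ∈ Z := by
      by_contra h
      simp [hu, h] at hux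
    have hxY : x ∈ Y := hRY hxZ.1
    obtain ⟨N, hN, h⟩ := mul_birkhoffSum_add_le_of_sparse hLT hYT hhit hsparse hxY
    refine ⟨N, hN, le_trans ?_ h⟩
    have h1 : ∀ i, u (T^[i] x) ≤ L x * birkhoffSum T (P.indicator (1 : X → ℕ)) (L x) (T^[i] x) := by
      intro i
      by_cases hi : T^[i] x ∈ Z
      · have hiY := (mem_iterate_of_invariant hYT i x).2 hxY
        have hgL := hγL _ hiY
        rw [invariant_iterate hLT] at hgL
        obtain ⟨_, j, hj, hjP⟩ := hi
        have h2 : 1 ≤ birkhoffSum T (P.indicator (1 : X → ℕ)) (L x) (T^[i] x) := by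
          calc 1 = P.indicator (1 : X → ℕ) (T^[j] (T^[i] x)) := by simp [hjP]
            _ ≤ _ := Finset.single_le_sum
              (f := fun k => P.indicator (1 : X → ℕ) (T^[k] (T^[i] x)))
              (fun _ _ => Nat.zero_le _) (Finset.mem_range.2 (hj.trans_le hgL))
        calc u (T^[i] x) ≤ γ (T^[i] x) := indicator_le_self' (fun _ _ => Nat.zero_le _) _
          _ ≤ L x * 1 := by omega
          _ ≤ _ := Nat.mul_le_mul_left _ h2
      · simp [hu, hi]
    calc birkhoffSum T u N x
        ≤ ∑ i ∈ Finset.range N, L x * birkhoffSum T (P.indicator (1 : X → ℕ)) (L x) (T^[i] x) :=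
          Finset.sum_le_sum fun i _ => h1 i
      _ = L x * birkhoffSum T (birkhoffSum T (P.indicator (1 : X → ℕ)) (L x)) N x := by
          rw [← Finset.mul_sum]; rfl
      _ ≤ L x * (L x * birkhoffSum T (P.indicator (1 : X → ℕ)) N x + L x * L x) :=
          Nat.mul_le_mul_left _ (birkhoffSum_birkhoffSum_le (indicator_one_le_one P) N (L x) x)
      _ = _ := by ring
  have hmaps : MapsTo (serve T u v) (cells u) (cells v) := mapsTo_serve hle
  have hinj : InjOn (serve T u v) (cells u) := injOn_serve T.injective
  have hzero : ∀ p ∈ cells u, (serve T u v p).1 ∈ R ∧ (serve T u v p).2 = 0 := by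
    intro p hp
    have h1 : _ < v _ := hmaps hp
    by_cases h2 : (serve T u v p).1 ∈ R
    · rw [hv, indicator_of_mem h2, Pi.one_apply] at h1
      exact ⟨h2, Nat.lt_one_iff.1 h1⟩
    · rw [hv, indicator_of_notMem h2] at h1
      omega
  set W : Set (X × ℕ) := {p | p ∈ cells u ∧ T^[p.2] p.1 ∈ P} with hW
  have hWm : MeasurableSet W := by
    refine MeasurableSet.inter (s₁ := cells u) (s₂ := {p | T^[p.2] p.1 ∈ P}) ?_ ?_
    · exact measurableSet_lt measurable_snd ((hum mX hT hRm hZm).comp measurable_fst)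
    · exact measurable_iterate_apply hT.1 measurable_snd measurable_fst hPm
  have hWu : W ⊆ cells u := fun p hp => hp.1
  set V : Set X := {y | (y, 0) ∈ serve T u v '' W} with hV
  refine ⟨Z, V, hZm, ?_, fun b hb => hb.1, ?_, ?_⟩
  · have h1 : MeasurableSet (serve T u v '' W) := hWm.image_of_measurable_injOn
      (measurable_serve hT.1 (hum mX hT hRm hZm) (hvm mX hRm)) (hinj.mono hWu)
    exact (measurable_id.prodMk measurable_const) h1
  · rintro y ⟨p, hp, hpy⟩
    have := (hzero p (hWu hp)).1
    rwa [hpy] at this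
  · intro m hTm hR hZ' hV'
    have hP : P = {x | ∃ i : ℕ, i < u ((T ^ (-(i : ℤ))) x) ∧
        (serve T u v ((T ^ (-(i : ℤ))) x, i)).1 ∈ V} := by
      ext x
      constructor
      · intro hx
        obtain ⟨b, hb, i, hi, rfl⟩ := exists_previous_visit hLT hYT hhit (hPY hx)
        have hbx : (T ^ (-(i : ℤ))) (T^[i] b) = b := by
          rw [Equiv.Perm.iterate_eq_pow, ← zpow_natCast, ← zpow_add_apply]; simp
        have hbZ : b ∈ Z := ⟨hb, i, hi, hx⟩
        have hc : (b, i) ∈ cells u := by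
          change i < u b
          rw [hu, indicator_of_mem hbZ]
          exact hi
        refine ⟨i, by rw [hbx]; exact hc, ?_⟩
        rw [hbx]
        exact ⟨(b, i), ⟨hc, hx⟩, Prod.ext rfl (hzero _ hc).2⟩
      · rintro ⟨i, hi, p, hp, hpV⟩
        have hc : ((T ^ (-(i : ℤ))) x, i) ∈ cells u := hi
        have h1 : serve T u v p = serve T u v ((T ^ (-(i : ℤ))) x, i) := by
          rw [hpV]
          exact Prod.ext rfl (hzero _ hc).2.symm
        have h2 := hinj (hWu hp) hc h1
        have h3 : T^[p.2] p.1 ∈ P := hp.2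
        rw [h2] at h3
        have hix : T^[i] ((T ^ (-(i : ℤ))) x) = x := by
          rw [Equiv.Perm.iterate_eq_pow, ← zpow_natCast, ← zpow_add_apply]; simp
        rwa [hix] at h3
    have hu' := hum m hTm hR hZ'
    have hs := measurable_serve hTm.1 hu' (hvm m hR)
    rw [hP]
    refine measurableSet_setOfPred.2 (.exists fun i => ?_)
    refine (measurableSet_setOfPred.1 (measurableSet_lt measurable_const (hu'.comp (hTm.zpow _)))).and
      (measurableSet_setOfPred.1 ?_)
    exact (measurable_fst.comp (hs.comp ((hTm.zpow _).prodMk measurable_const))) hV'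

end SparseCode

section Hierarchy

variable {X : Type*} {T : Equiv.Perm X}

theorem exists_marker_hierarchy [mX : MeasurableSpace X] [StandardBorelSpace X] (hT : IsAuto T mX)
    (hap : ∀ x, ∀ n : ℤ, n ≠ 0 → (T ^ n) x ≠ x) {M : X → ℕ} (hM : Measurable M)
    (hMT : ∀ x, M (T x) = M x) (hpos : ∀ x, 0 < M x) {B : Set X} (hB : MeasurableSet B)
    (hnear : ∀ x, ∃ i : ℤ, |i| < M x ∧ (T ^ i) x ∈ B) :
    ∃ R : ℕ → Set X, R 0 = B ∧ (∀ k, R (k + 1) ⊆ R k) ∧ (∀ k, MeasurableSet (R k)) ∧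
      (∀ k, Discrete T (fun x => 8 ^ (k + 1) * M x) (R (k + 1))) ∧
      ∀ k x, ∃ i : ℤ, |i| < (2 * 8 ^ k * M x : ℕ) ∧ (T ^ i) x ∈ R k := by
  have key : ∀ (k : ℕ) (W : Set X), MeasurableSet W → ∃ B ⊆ W, MeasurableSet B ∧
      Discrete T (fun x => 8 ^ (k + 1) * M x) B ∧
      ∀ w ∈ W, ∃ i : ℤ, |i| < (8 ^ (k + 1) * M w : ℕ) ∧ (T ^ i) w ∈ B := by
    intro k W hW
    exact exists_marker (M := fun x => 8 ^ (k + 1) * M x) hT hap (measurable_const.mul hM)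
      (fun x => by simp only [hMT])
      (fun x => Nat.mul_pos (by positivity) (hpos x)) hW
  choose! next h1 h2 h3 h4 using key
  let R : ℕ → Set X := fun k => Nat.rec B next k
  have hR : ∀ k, MeasurableSet (R k) := by
    intro k
    induction k with
    | zero => exact hB
    | succ k ih => exact h2 k _ ih
  refine ⟨R, rfl, fun k => h1 k _ (hR k), hR, fun k => h3 k _ (hR k), fun k => ?_⟩
  induction k with
  | zero =>
    intro x
    obtain ⟨i, hi, hiB⟩ := hnear x
    exact ⟨i, by have := hpos x; push_cast; omega, hiB⟩
  | succ k ih =>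
    intro x
    obtain ⟨i, hi, hiR⟩ := ih x
    obtain ⟨j, hj, hjR⟩ := h4 k _ (hR k) _ hiR
    rw [invariant_zpow hMT] at hj
    refine ⟨j + i, ?_, by rw [zpow_add_apply]; exact hjR⟩
    have := abs_add_le j i
    rw [pow_succ] at hj ⊢
    push_cast at hi hj ⊢
    have h8 : (0 : ℤ) < 8 ^ k * M x := by have := hpos x; positivity
    nlinarith

/-- The next point of `S` strictly after `x` on its orbit. -/
noncomputable def nextVisit (T : Equiv.Perm X) (S : Set X) (x : X) : X := T^[hit T S (T x)] (T x)

theorem measurable_nextVisit {m : MeasurableSpace X} (hT : IsAuto T m) {S : Set X}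
    (hS : MeasurableSet S) : Measurable (nextVisit T S) :=
  measurable_iterate_apply hT.1 ((measurable_hit hT hS).comp hT.1) hT.1

theorem injOn_nextVisit (S : Set X) : InjOn (nextVisit T S) S := by
  have key : ∀ x ∈ S, ∀ y ∈ S, nextVisit T S x = nextVisit T S y →
      hit T S (T x) ≤ hit T S (T y) → x = y := by
    intro x hx y hy h hle
    obtain ⟨n, hn⟩ := Nat.exists_eq_add_of_le hle
    simp only [nextVisit] at h
    rw [hn, iterate_add_apply] at h
    have h1 : T x = T^[n] (T y) := (T.injective.iterate _) h
    rw [← iterate_succ_apply, iterate_succ_apply'] at h1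
    have h2 : x = T^[n] y := T.injective h1
    cases n with
    | zero => exact h2
    | succ n =>
      rw [iterate_succ_apply] at h2
      have : hit T S (T y) ≤ n := hit_le (by rw [← h2]; exact hx)
      omega
  intro x hx y hy h
  rcases le_total (hit T S (T x)) (hit T S (T y)) with hle | hle
  · exact key x hx y hy h hle
  · exact (key y hy x hx h.symm hle).symm

theorem exists_layers [mX : MeasurableSpace X] [StandardBorelSpace X] (hT : IsAuto T mX)
    (hap : ∀ x, ∀ n : ℤ, n ≠ 0 → (T ^ n) x ≠ x) {M : X → ℕ} (hM : Measurable M)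
    (hMT : ∀ x, M (T x) = M x) (hpos : ∀ x, 0 < M x) {B : Set X} (hB : MeasurableSet B)
    (hnear : ∀ x, ∃ i : ℤ, |i| < M x ∧ (T ^ i) x ∈ B) {Y : Set X} (hY : MeasurableSet Y)
    (hYT : ∀ x, T x ∈ Y ↔ x ∈ Y) :
    ∃ S : ℕ → Set X, S 0 = B ∩ Y ∧ Antitone S ∧ (∀ k, MeasurableSet (S k)) ∧
      (∀ k, ∀ x ∈ S (k + 1), nextVisit T (S k) x ∈ S k \ S (k + 1)) ∧
      ∀ k, ∀ x ∈ Y, ∃ j < 8 ^ (k + 1) * M x + 1, T^[j] x ∈ S k \ S (k + 1) := by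
  obtain ⟨R, hR0, hRanti, hR, hRdisc, hRnear⟩ := exists_marker_hierarchy hT hap hM hMT hpos hB hnear
  have hhit : ∀ k, ∀ x ∈ Y, ∃ j < 2 * (2 * 8 ^ k * M x), T^[j] x ∈ R k ∩ Y := by
    intro k x hx
    obtain ⟨j, hj, hjR⟩ := exists_iterate_mem_of_near (M := fun x => 2 * 8 ^ k * M x)
      (fun x => by simp only [hMT]) (hRnear k) x
    exact ⟨j, hj, hjR, (mem_iterate_of_invariant hYT j x).2 hx⟩
  have hlt : ∀ k, ∀ x ∈ Y, hit T (R k ∩ Y) (T x) < 4 * (8 ^ k * M x) := by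
    intro k x hx
    obtain ⟨j, hj, hjR⟩ := hhit k (T x) ((hYT x).2 hx)
    rw [hMT] at hj
    have := hit_le hjR
    nlinarith
  have hnext : ∀ k, ∀ x ∈ R (k + 1) ∩ Y,
      nextVisit T (R k ∩ Y) x ∈ (R k ∩ Y) \ (R (k + 1) ∩ Y) := by
    rintro k x ⟨hxR, hxY⟩
    obtain ⟨j, _, hj⟩ := hhit k (T x) ((hYT x).2 hxY)
    refine ⟨iterate_hit_mem ⟨j, hj⟩, fun hmem => ?_⟩
    have h1 := hlt k x hxY
    refine hRdisc k x hxR (hit T (R k ∩ Y) (T x) + 1 : ℕ) (by omega) ?_ ?_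
    · rw [pow_succ, abs_of_nonneg (by positivity)]
      have : 0 < 8 ^ k * M x := Nat.mul_pos (by positivity) (hpos x)
      exact_mod_cast (by nlinarith :
        hit T (R k ∩ Y) (T x) + 1 < 8 ^ k * 8 * M x)
    · rw [zpow_natCast, ← Equiv.Perm.iterate_eq_pow, iterate_succ_apply]
      exact hmem.1
  refine ⟨fun k => R k ∩ Y, by simp only [hR0], antitone_nat_of_succ_le fun k =>
    inter_subset_inter_left _ (hRanti k), fun k => (hR k).inter hY, hnext, fun k x hx => ?_⟩
  obtain ⟨j, hj, hjR⟩ := hhit k x hx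
  by_cases hmem : T^[j] x ∈ R (k + 1) ∩ Y
  · have h1 := hlt k _ hjR.2
    rw [invariant_iterate hMT] at h1
    refine ⟨hit T (R k ∩ Y) (T (T^[j] x)) + 1 + j, ?_, ?_⟩
    · rw [pow_succ]
      nlinarith
    · rw [iterate_add_apply, iterate_succ_apply]
      exact hnext k _ hmem
  · refine ⟨j, ?_, hjR, hmem⟩
    rw [pow_succ]
    nlinarith

theorem eq_of_mem_layers {S : ℕ → Set X} (hS : Antitone S) {k l : ℕ} {x : X}
    (hk : x ∈ S k \ S (k + 1)) (hl : x ∈ S l \ S (l + 1)) : k = l := by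
  rcases lt_trichotomy k l with h | h | h
  · exact absurd (hS h hl.1) hk.2
  · exact h
  · exact absurd (hS h hk.1) hl.2

theorem exists_code_of_layers [mX : MeasurableSpace X] (hT : IsAuto T mX) {S : ℕ → Set X}
    (hanti : Antitone S) (hS : ∀ k, MeasurableSet (S k))
    (hnext : ∀ k, ∀ x ∈ S (k + 1), nextVisit T (S k) x ∈ S k \ S (k + 1)) :
    ∃ E ⊆ S 0, MeasurableSet E ∧ ∀ m : MeasurableSpace X, IsAuto T m → MeasurableSet[m] (S 0) →
      MeasurableSet[m] (S 1) → MeasurableSet[m] E → ∀ k, MeasurableSet[m] (S k) := by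
  set E : Set X := {y | ∃ k, y ∈ S k \ S (k + 1) ∧ ∃ n : ℕ, (T ^ (-((n : ℤ) + 1))) y ∈ S (k + 2) ∧
    hit T (S k) (T ((T ^ (-((n : ℤ) + 1))) y)) = n}
  have hcancel : ∀ (n : ℕ) (y : X), T^[n] (T ((T ^ (-((n : ℤ) + 1))) y)) = y := by
    intro n y
    rw [← iterate_succ_apply, Equiv.Perm.iterate_eq_pow, ← zpow_natCast, ← zpow_add_apply]
    simp
  refine ⟨E, fun y ⟨k, hy, _⟩ => hanti (Nat.zero_le k) hy.1, ?_, ?_⟩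
  · refine measurableSet_setOfPred.2 (.exists fun k =>
      (((hS k).diff (hS (k + 1))).mem).and (.exists fun n => ?_))
    refine (measurableSet_setOfPred.1 (hT.zpow _ (hS (k + 2)))).and (measurableSet_setOfPred.1 ?_)
    exact measurableSet_eq_fun ((measurable_hit hT (hS k)).comp (hT.1.comp (hT.zpow _)))
      measurable_const
  · intro m hTm h0 h1 hEm
    have hdec : ∀ k, S (k + 2) = S (k + 1) ∩ nextVisit T (S k) ⁻¹' E := by
      intro k
      ext x
      constructor
      · intro hx
        have hx1 : x ∈ S (k + 1) := hanti (Nat.le_succ _) hx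
        refine ⟨hx1, k, hnext k x hx1, hit T (S k) (T x), ?_⟩
        have hb : (T ^ (-((hit T (S k) (T x) : ℤ) + 1))) (nextVisit T (S k) x) = x := by
          rw [nextVisit, ← iterate_succ_apply, Equiv.Perm.iterate_eq_pow, ← zpow_natCast,
            ← zpow_add_apply]
          simp
        rw [hb]
        exact ⟨hx, rfl⟩
      · rintro ⟨hx1, l, hl, n, hn, hhit⟩
        obtain rfl := eq_of_mem_layers hanti (hnext k x hx1) hl
        have := injOn_nextVisit (S k) (hanti (by omega) hn) (hanti (by omega) hx1)
          (by rw [nextVisit, hhit, hcancel])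
        rwa [this] at hn
    have key : ∀ k, MeasurableSet[m] (S k) ∧ MeasurableSet[m] (S (k + 1)) := by
      intro k
      induction k with
      | zero => exact ⟨h0, h1⟩
      | succ k ih =>
        refine ⟨ih.2, ?_⟩
        rw [hdec k]
        exact ih.2.inter (measurable_nextVisit hTm ih.1 hEm)
    exact fun k => (key k).1

end Hierarchy

section Partition

variable {X : Type*} [mX : MeasurableSpace X] {T : Equiv.Perm X}

theorem exists_sparse_partition {Y : Set X} (hY : MeasurableSet Y)
    (hYT : ∀ x, T x ∈ Y ↔ x ∈ Y) {κ c : X → ℕ} (hκ0 : ∀ x, 0 < κ x) (hc : Measurable c)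
    {d : ℕ → X → ℝ} (hd : ∀ n, Measurable (d n)) (hdT : ∀ n x, d n (T x) = d n x)
    (hlim : ∀ x ∈ Y, ∀ n, 1 ≤ κ x * d n x ∧
      Tendsto (fun N : ℕ => birkhoffSum T ({x | n ≤ c x}.indicator (1 : X → ℝ)) N x / N) atTop
        (𝓝 (d n x)))
    {A : ℕ → X → ℕ} (hA : ∀ k, Measurable (A k)) (hAT : ∀ k x, A k (T x) = A k x)
    (hAmono : ∀ k x, A k x ≤ A (k + 1) x) :
    ∃ P : ℕ → Set X, (∀ k, MeasurableSet (P k)) ∧ (∀ k, P k ⊆ Y) ∧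
      (∀ k, ∀ x ∈ Y, ∀ᶠ N : ℕ in atTop,
        A k x * birkhoffSum T ((P k).indicator (1 : X → ℕ)) N x ≤ N) ∧
      ∀ x ∈ Y, ∀ᶠ N : ℕ in atTop,
        N ≤ 2 * κ x * birkhoffSum T ((⋃ k, P k).indicator (1 : X → ℕ)) N x := by
  classical
  set n : ℕ → X → ℕ := fun k x => sInf {n | k ≤ n ∧ ∀ j, A k x * (d n x - d (n + j) x) < 1} with hn
  have hnm : ∀ k, Measurable (n k) := fun k => measurable_sInf_nat fun i =>
    (MeasurableSet.const _).inter (measurableSet_setOfPred.2 (.forall fun j =>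
      measurableSet_setOfPred.1 (measurableSet_lt
        ((measurable_from_nat.comp (hA k)).mul ((hd _).sub (hd _))) measurable_const)))
  have hnT : ∀ k x, n k (T x) = n k x := fun k x => by simp only [hn, hAT, hdT]
  have hanti : ∀ x ∈ Y, Antitone fun i => d i x := by
    intro x hx i j hij
    refine le_of_tendsto_of_tendsto' (hlim x hx j).2 (hlim x hx i).2 fun N => ?_
    gcongr
    refine Finset.sum_le_sum fun l _ => ?_
    refine indicator_le_indicator_of_subset (fun y hy => ?_) (fun _ => zero_le_one) _
    exact hij.trans hy
  have hspec : ∀ x ∈ Y, ∀ k, k ≤ n k x ∧ ∀ j, A k x * (d (n k x) x - d (n k x + j) x) < 1 := by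
    intro x hx k
    refine Nat.sInf_mem (s := {n | k ≤ n ∧ ∀ j, A k x * (d n x - d (n + j) x) < 1}) ?_
    have hbdd : BddBelow (range fun i => d i x) := by
      refine ⟨0, ?_⟩
      rintro _ ⟨i, rfl⟩
      by_contra! hneg
      have := (hlim x hx i).1
      have hκ : (0 : ℝ) < κ x := by exact_mod_cast hκ0 x
      nlinarith
    have ht := tendsto_atTop_ciInf (hanti x hx) hbdd
    set l := ⨅ i, d i x
    have ht2 : Tendsto (fun i => A k x * (d i x - l)) atTop (𝓝 0) := by
      simpa using (ht.sub_const l).const_mul (A k x : ℝ)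
    obtain ⟨i, hi, hik⟩ := ((ht2.eventually (gt_mem_nhds zero_lt_one)).and
      (eventually_ge_atTop k)).exists
    refine ⟨i, hik, fun j => lt_of_le_of_lt ?_ hi⟩
    have : l ≤ d (i + j) x := ciInf_le hbdd _
    gcongr
  have hmono : ∀ x ∈ Y, Monotone fun k => n k x := by
    intro x hx
    refine monotone_nat_of_le_succ fun k => ?_
    obtain ⟨h1, h2⟩ := hspec x hx (k + 1)
    refine Nat.sInf_le ⟨by omega, fun j => lt_of_le_of_lt ?_ (h2 j)⟩
    have : d (n (k + 1) x + j) x ≤ d (n (k + 1) x) x := hanti x hx (Nat.le_add_right _ _)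
    have h3 : (A k x : ℝ) ≤ A (k + 1) x := by exact_mod_cast hAmono k x
    exact mul_le_mul_of_nonneg_right h3 (by linarith)
  set P : ℕ → Set X := fun k => {x | x ∈ Y ∧ n k x ≤ c x ∧ c x < n (k + 1) x} with hP
  have hU : ⋃ k, P k = {x | x ∈ Y ∧ n 0 x ≤ c x} := by
    ext x
    simp only [hP, mem_iUnion, mem_ofPred_eq]
    constructor
    · rintro ⟨k, hx, h1, h2⟩
      exact ⟨hx, (hmono x hx (Nat.zero_le k)).trans h1⟩
    · rintro ⟨hx, h1⟩
      have hex : ∃ k, c x < n k x := ⟨c x + 1, (hspec x hx (c x + 1)).1⟩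
      have h2 := Nat.find_spec hex
      have h3 : Nat.find hex ≠ 0 := fun h0 => by rw [h0] at h2; omega
      obtain ⟨k, hk⟩ := Nat.exists_eq_succ_of_ne_zero h3
      refine ⟨k, hx, not_lt.1 (Nat.find_min hex (by omega)), ?_⟩
      rw [hk] at h2
      exact h2
  refine ⟨P, fun k => ?_, fun k x hx => hx.1, fun k x hx => ?_, fun x hx => ?_⟩
  · exact hY.inter ((measurableSet_le (hnm k) hc).inter (measurableSet_lt hc (hnm (k + 1))))
  · have h1 : ∀ N : ℕ, birkhoffSum T ({y | n k x ≤ c y}.indicator (1 : X → ℝ)) N x -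
        birkhoffSum T ({y | n (k + 1) x ≤ c y}.indicator (1 : X → ℝ)) N x
        = (birkhoffSum T ((P k).indicator (1 : X → ℕ)) N x : ℕ) := by
      intro N
      rw [← birkhoffSum_indicator_cast]
      simp only [birkhoffSum, ← Finset.sum_sub_distrib]
      refine Finset.sum_congr rfl fun i _ => ?_
      have hi1 : n k (T^[i] x) = n k x := invariant_iterate (hnT k) i x
      have hi2 : n (k + 1) (T^[i] x) = n (k + 1) x := invariant_iterate (hnT (k + 1)) i x
      have hiY := (mem_iterate_of_invariant hYT i x).2 hx
      have hle : n k x ≤ n (k + 1) x := hmono x hx (Nat.le_succ k)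
      simp only [indicator_apply, hP, mem_ofPred_eq, hi1, hi2, hiY, true_and, Pi.one_apply]
      split_ifs <;> first | omega | norm_num
    have h2 := ((hlim x hx (n k x)).2.sub (hlim x hx (n (k + 1) x)).2).const_mul (A k x : ℝ)
    have h3 : A k x * (d (n k x) x - d (n (k + 1) x) x) < 1 := by
      have h4 := (hspec x hx k).2 (n (k + 1) x - n k x)
      have hle : n k x ≤ n (k + 1) x := hmono x hx (Nat.le_succ k)
      rwa [Nat.add_sub_of_le hle] at h4
    refine ((h2.eventually (gt_mem_nhds h3)).and (eventually_gt_atTop 0)).mono ?_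
    rintro N ⟨hN, hN0⟩
    have hN0' : (0 : ℝ) < N := by exact_mod_cast hN0
    rw [← sub_div, h1, ← mul_div_assoc, div_lt_one hN0'] at hN
    exact_mod_cast hN.le
  · have h1 : ∀ N : ℕ, birkhoffSum T ({y | n 0 x ≤ c y}.indicator (1 : X → ℝ)) N x
        = (birkhoffSum T ((⋃ k, P k).indicator (1 : X → ℕ)) N x : ℕ) := by
      intro N
      rw [← birkhoffSum_indicator_cast, hU]
      refine birkhoffSum_congr_orbit (fun i => ?_) N
      have hi1 : n 0 (T^[i] x) = n 0 x := invariant_iterate (hnT 0) i x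
      have hiY := (mem_iterate_of_invariant hYT i x).2 hx
      simp only [indicator_apply, mem_ofPred_eq, hi1, hiY, true_and]
    obtain ⟨h2, h3⟩ := hlim x hx (n 0 x)
    have hlt : (1 : ℝ) < 2 * κ x * d (n 0 x) x := by linarith
    have h4 := h3.const_mul (2 * κ x : ℝ)
    refine ((h4.eventually (lt_mem_nhds hlt)).and (eventually_gt_atTop 0)).mono ?_
    rintro N ⟨hN, hN0⟩
    have hN0' : (0 : ℝ) < N := by exact_mod_cast hN0
    rw [h1, ← mul_div_assoc, one_lt_div hN0'] at hN
    exact_mod_cast hN.le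

end Partition

section Deficient

variable {X : Type*} {T : Equiv.Perm X}

theorem iUnion_inter_eq_of_subset {Z R : ℕ → Set X} (hZ : ∀ k, Z k ⊆ R k)
    (hR : ∀ {k l x}, x ∈ R k → x ∈ R l → k = l) (k : ℕ) : (⋃ l, Z l) ∩ R k = Z k := by
  ext x
  constructor
  · rintro ⟨hx, hxk⟩
    obtain ⟨l, hl⟩ := mem_iUnion.1 hx
    obtain rfl := hR (hZ l hl) hxk
    exact hl
  · exact fun hx => ⟨mem_iUnion.2 ⟨k, hx⟩, hZ k hx⟩

theorem mem_cells_indicator {S : Set X} {p : X × ℕ} :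
    p ∈ cells (S.indicator (1 : X → ℕ)) ↔ p.1 ∈ S ∧ p.2 = 0 := by
  change p.2 < S.indicator 1 p.1 ↔ _
  by_cases h : p.1 ∈ S <;> simp [h]

/-- Matchings of the members of a family into those of a disjoint family can be glued together. -/
theorem exists_glued_serve {P R : ℕ → Set X}
    (hR : ∀ {k l x}, x ∈ R k → x ∈ R l → k = l)
    (h : ∀ k, ∀ x ∈ P k, ∃ N, 0 < N ∧ birkhoffSum T ((P k).indicator (1 : X → ℕ)) N x
      ≤ birkhoffSum T ((R k).indicator (1 : X → ℕ)) N x) :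
    ∃ Φ : X × ℕ → X × ℕ, InjOn Φ (cells ((⋃ k, P k).indicator 1)) ∧
      MapsTo Φ (cells ((⋃ k, P k).indicator 1)) (cells ((⋃ k, R k).indicator 1)) ∧
      ∀ m : MeasurableSpace X, IsAuto T m → (∀ k, MeasurableSet[m] (P k)) →
        (∀ k, MeasurableSet[m] (R k)) → Measurable[m.prod ⊤, m.prod ⊤] Φ := by
  set J : X → ℕ := fun x => sInf {k | x ∈ P k} with hJ
  have hJP : ∀ x ∈ ⋃ k, P k, x ∈ P (J x) := fun x hx =>
    Nat.sInf_mem (s := {k | x ∈ P k}) (mem_iUnion.1 hx)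
  let φ : ℕ → X × ℕ → X × ℕ := fun k =>
    serve T ((P k).indicator (1 : X → ℕ)) ((R k).indicator (1 : X → ℕ))
  have hφ : ∀ k, MapsTo (φ k) (cells ((P k).indicator 1)) (cells ((R k).indicator 1)) := by
    refine fun k => mapsTo_serve fun x hx => h k x ?_
    by_contra hxP
    simp [hxP] at hx
  have hcell : ∀ p ∈ cells ((⋃ k, P k).indicator (1 : X → ℕ)),
      p ∈ cells ((P (J p.1)).indicator (1 : X → ℕ)) := fun p hp => by
    rw [mem_cells_indicator] at hp ⊢
    exact ⟨hJP _ hp.1, hp.2⟩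
  refine ⟨fun p => φ (J p.1) p, fun p hp q hq hpq => ?_, fun p hp => ?_, ?_⟩
  · have h1 := mem_cells_indicator.1 (hφ _ (hcell p hp))
    have h2 := mem_cells_indicator.1 (hφ _ (hcell q hq))
    dsimp only at hpq
    have h3 : J p.1 = J q.1 := hR h1.1 (by rw [hpq]; exact h2.1)
    have hp' := hcell p hp
    rw [h3] at hpq hp'
    exact injOn_serve T.injective hp' (hcell q hq) hpq
  · have h1 := mem_cells_indicator.1 (hφ _ (hcell p hp))
    exact mem_cells_indicator.2 ⟨mem_iUnion.2 ⟨_, h1.1⟩, h1.2⟩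
  · intro m hTm hPm hRm
    have hJm : Measurable[m] J := measurable_sInf_nat hPm
    exact measurable_select (hJm.comp measurable_fst) fun k =>
      measurable_serve hTm.1 (measurable_one.indicator (hPm k)) (measurable_one.indicator (hRm k))

theorem exists_code_of_deficient [mX : MeasurableSpace X] [StandardBorelSpace X]
    (hT : IsAuto T mX) (hap : ∀ x, ∀ n : ℤ, n ≠ 0 → (T ^ n) x ≠ x) {M κ : X → ℕ}
    (hM : Measurable M) (hMT : ∀ x, M (T x) = M x)
    (hκ0 : ∀ x, 0 < κ x) (hMκ : ∀ x, 200 * κ x ≤ M x)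
    {B : Set X} (hB : MeasurableSet B) (hdisc : Discrete T M B)
    (hnear : ∀ x, ∃ i : ℤ, |i| < M x ∧ (T ^ i) x ∈ B) {Y : Set X} (hY : MeasurableSet Y)
    (hYT : ∀ x, T x ∈ Y ↔ x ∈ Y) {c : X → ℕ} (hc : Measurable c)
    {d : ℕ → X → ℝ} (hd : ∀ n, Measurable (d n)) (hdT : ∀ n x, d n (T x) = d n x)
    (hlim : ∀ x ∈ Y, ∀ n, 1 ≤ κ x * d n x ∧
      Tendsto (fun N : ℕ => birkhoffSum T ({x | n ≤ c x}.indicator (1 : X → ℝ)) N x / N) atTop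
        (𝓝 (d n x))) :
    ∃ D : ℕ → Set X, (∀ j, MeasurableSet (D j)) ∧ (∀ j, D j ⊆ B ∩ Y) ∧
      (∀ j, ∀ b ∈ D j, 4 * j + 9 ≤ M b) ∧ IsCode T B Y D := by
  have hpos : ∀ x, 0 < M x := fun x => by have := hκ0 x; have := hMκ x; omega
  obtain ⟨S, hS0, hSanti, hS, hSnext, hShit⟩ := exists_layers hT hap hM hMT hpos hB hnear hY hYT
  obtain ⟨E, hES, hE, hEcode⟩ := exists_code_of_layers hT hSanti hS hSnext
  let L : ℕ → X → ℕ := fun k x => 8 ^ (k + 1) * M x + 1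
  have hLT : ∀ k x, L k (T x) = L k x := fun k x => by simp only [L, hMT]
  have hLm : ∀ k, Measurable (L k) := fun k => (measurable_const.mul hM).add_const 1
  obtain ⟨P, hP, hPY, hPsparse, hPdense⟩ := exists_sparse_partition hY hYT hκ0 hc hd hdT hlim
    (A := fun k x => 2 * L k x ^ 3) (fun k => ((hLm k).pow_const 3).const_mul 2)
    (fun k x => by simp only [hLT]) (fun k x => by
      simp only [L]
      gcongr <;> omega)
  let R : ℕ → Set X := fun k => S k \ S (k + 1)
  have hR : ∀ k, MeasurableSet (R k) := fun k => (hS k).diff (hS (k + 1))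
  have hRB : ∀ k, R k ⊆ B ∩ Y := fun k x hx => hS0 ▸ hSanti (Nat.zero_le k) hx.1
  have hRdisj : ∀ {k l x}, x ∈ R k → x ∈ R l → k = l := eq_of_mem_layers hSanti
  have hcode := fun k => exists_code_of_sparse hT (hLT k) hYT (hR k)
    (fun x hx => (hRB k hx).2) (hP k) (hPY k) (hShit k) (hPsparse k)
  choose Z V hZ hV hZR hVR hZV using hcode
  obtain ⟨Φ, hΦinj, hΦmaps, hΦm⟩ := exists_glued_serve (T := T) hRdisj fun k x hx =>
    exists_birkhoffSum_le_of_sparse (hLT k) hYT (hShit k) (hPsparse k) (hPY k hx)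
  set e : X → ℕ := (B ∩ Y).indicator 1 with he
  set q : X → ℕ := (⋃ k, P k).indicator 1 with hq
  have hχ : ∀ x, 0 < (e + e) x → ∃ N, 0 < N ∧
      birkhoffSum T (e + e) N x ≤ birkhoffSum T q N x := by
    intro x hx
    have hxB : x ∈ B ∩ Y := by
      by_contra h
      simp only [he, Pi.add_apply, indicator_of_notMem h, add_zero, lt_irrefl] at hx
    obtain ⟨N, h1, h2⟩ := ((hPdense x hxB.2).and (eventually_gt_atTop (M x * M x))).exists
    refine ⟨N, by omega, ?_⟩
    have h3 := mul_birkhoffSum_indicator_le_of_discrete hMT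
      (hdisc.mono (inter_subset_left (t := Y))) N x
    rw [show birkhoffSum T (e + e) N x = birkhoffSum T e N x + birkhoffSum T e N x from
      Finset.sum_add_distrib]
    have h4 := hMκ x
    refine le_of_mul_le_mul_left (a := M x) ?_ (hpos x)
    change N ≤ 2 * κ x * birkhoffSum T q N x at h1
    change M x * birkhoffSum T e N x ≤ _ at h3
    nlinarith
  have hsub : cells ((⋃ k, R k).indicator (1 : X → ℕ)) ⊆ cells e := fun p hp => by
    rw [mem_cells_indicator] at hp
    exact mem_cells_indicator.2 ⟨iUnion_subset hRB hp.1, hp.2⟩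
  set ψ : X × ℕ → X × ℕ := Φ ∘ serve T (e + e) q with hψ
  have hmaps : MapsTo ψ (cells (e + e)) (cells e) :=
    (hΦmaps.comp (mapsTo_serve hχ)).mono_right hsub
  have hinj : InjOn ψ (cells (e + e)) :=
    hΦinj.comp (injOn_serve T.injective) (mapsTo_serve hχ)
  have hψm : ∀ m : MeasurableSpace X, IsAuto T m → MeasurableSet[m] (B ∩ Y) →
      (∀ k, MeasurableSet[m] (P k)) → (∀ k, MeasurableSet[m] (R k)) →
      Measurable[m.prod ⊤, m.prod ⊤] (absorb e ψ) := by
    intro m hTm hBY hPm hRm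
    have hem : Measurable[m] e := measurable_one.indicator hBY
    have hqm : Measurable[m] q := measurable_one.indicator (MeasurableSet.iUnion hPm)
    exact measurable_absorb hem
      ((hΦm m hTm hPm hRm).comp (measurable_serve hTm.1 (hem.add hem) hqm))
  have hset : {p : X × ℕ | 0 < e p.1} = {p | p.1 ∈ B ∩ Y} := by
    ext p
    by_cases hp : p.1 ∈ B ∩ Y
    · simp only [he, mem_ofPred_eq, indicator_of_mem hp, Pi.one_apply, zero_lt_one, hp]
    · simp only [he, mem_ofPred_eq, indicator_of_notMem hp, lt_irrefl, hp]
  obtain ⟨hai, ham⟩ := absorb_spec hinj hmaps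
  rw [hset] at hai ham
  obtain ⟨F, hF, hFe, hFcode⟩ := exists_storage (hB.inter hY)
    (hψm mX hT (hB.inter hY) hP hR) hai ham
  have hFj : ∀ j, ∀ x ∈ F j, x ∈ B ∩ Y ∧ j = 0 := fun j x hx =>
    (mem_cells_indicator (p := (x, j))).1 (hFe j x hx)
  let D : ℕ → Set X := fun j => match j with
    | 0 => S 1
    | 1 => E
    | 2 => ⋃ k, Z k
    | 3 => ⋃ k, V k
    | 4 => F 0
    | _ => ∅
  have hDsub : ∀ j, D j ⊆ B ∩ Y ∧ (4 < j → D j = ∅) := by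
    intro j
    match j with
    | 0 => exact ⟨hS0 ▸ hSanti (Nat.zero_le 1), by omega⟩
    | 1 => exact ⟨hS0 ▸ hES, by omega⟩
    | 2 => exact ⟨iUnion_subset fun k => (hZR k).trans (hRB k), by omega⟩
    | 3 => exact ⟨iUnion_subset fun k => (hVR k).trans (hRB k), by omega⟩
    | 4 => exact ⟨fun x hx => (hFj 0 x hx).1, by omega⟩
    | n + 5 => exact ⟨empty_subset _, fun _ => rfl⟩
  refine ⟨D, fun j => ?_, fun j => (hDsub j).1, fun j b hb => ?_, ?_⟩
  · match j with
    | 0 => exact hS 1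
    | 1 => exact hE
    | 2 => exact MeasurableSet.iUnion hZ
    | 3 => exact MeasurableSet.iUnion hV
    | 4 => exact hF 0
    | n + 5 => exact MeasurableSet.empty
  · have h1 : j ≤ 4 := by
      by_contra! h
      rw [(hDsub j).2 h] at hb
      exact hb
    have := hκ0 b
    have := hMκ b
    omega
  · intro m hTm hBm hYm hDm
    have hSm : ∀ k, MeasurableSet[m] (S k) :=
      hEcode m hTm (hS0 ▸ hBm.inter hYm) (hDm 0) (hDm 1)
    have hRm : ∀ k, MeasurableSet[m] (R k) := fun k => (hSm k).diff (hSm (k + 1))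
    have hPm : ∀ k, MeasurableSet[m] (P k) := by
      intro k
      refine hZV k m hTm (hRm k) ?_ ?_
      · rw [← iUnion_inter_eq_of_subset hZR hRdisj k]
        exact (hDm 2).inter (hRm k)
      · rw [← iUnion_inter_eq_of_subset hVR hRdisj k]
        exact (hDm 3).inter (hRm k)
    refine hFcode m (hBm.inter hYm) (hψm m hTm (hBm.inter hYm) hPm hRm) fun j => ?_
    rcases Nat.eq_zero_or_pos j with rfl | hj
    · exact hDm 4
    · have : F j = ∅ := by
        ext x
        exact ⟨fun hx => absurd (hFj j x hx).2 hj.ne', fun hx => absurd hx (notMem_empty x)⟩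
      rw [this]
      exact MeasurableSet.empty

end Deficient

section Combination

variable {X : Type*} {T : Equiv.Perm X}

theorem measurableSet_of_inter_recurrent {m : MeasurableSpace X} (hT : IsAuto T m) {B Y : Set X}
    (hYT : ∀ x, T x ∈ Y ↔ x ∈ Y) (hrec : ∀ x, ∃ n : ℤ, (T ^ n) x ∈ B)
    (h : MeasurableSet (B ∩ Y)) : MeasurableSet Y := by
  have : Y = ⋃ n : ℤ, (T ^ n) ⁻¹' (B ∩ Y) := by
    ext x
    simp only [mem_iUnion, mem_preimage, mem_inter_iff, mem_zpow_of_invariant hYT]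
    exact ⟨fun hx => (hrec x).imp fun n hn => ⟨hn, hx⟩, fun ⟨_, hx⟩ => hx.2⟩
  rw [this]
  exact MeasurableSet.iUnion fun n => hT.zpow n h

theorem exists_generator_of_codes [mX : MeasurableSpace X] [StandardBorelSpace X]
    (hT : IsAuto T mX) {M : X → ℕ} (hMT : ∀ x, M (T x) = M x) (hM : ∀ x, 9 ≤ M x)
    {B : Set X} (hB : MeasurableSet B) (hdisc : Discrete T M B)
    (hrec : ∀ x, ∃ n : ℤ, (T ^ n) x ∈ B) {Y : Set X} (hY : MeasurableSet Y)
    (hYT : ∀ x, T x ∈ Y ↔ x ∈ Y) {D D' : ℕ → Set X} (hD : ∀ j, MeasurableSet (D j))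
    (hDB : ∀ j, D j ⊆ B ∩ Y) (hDM : ∀ j, ∀ b ∈ D j, 4 * j + 9 ≤ M b) (hcode : IsCode T B Y D)
    (hD' : ∀ j, MeasurableSet (D' j)) (hDB' : ∀ j, D' j ⊆ B ∩ Yᶜ)
    (hDM' : ∀ j, ∀ b ∈ D' j, 4 * j + 9 ≤ M b) (hcode' : IsCode T B Yᶜ D') :
    ∃ A, MeasurableSet A ∧
      MeasurableSpace.generateFrom {s | ∃ n : ℤ, s = ⇑(T ^ n) '' A} = mX := by
  let C : ℕ → Set X := fun n => if n = 0 then B ∩ Y else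
    if n % 2 = 1 then D (n / 2) else D' (n / 2 - 1)
  have hC1 : ∀ j, C (2 * j + 1) = D j := fun j => by
    simp only [C, Nat.add_eq_zero_iff, one_ne_zero, and_false, if_false]
    rw [if_pos (by omega), show (2 * j + 1) / 2 = j by omega]
  have hC2 : ∀ j, C (2 * j + 2) = D' j := fun j => by
    simp only [C, Nat.add_eq_zero_iff, OfNat.ofNat_ne_zero, and_false, if_false]
    rw [if_neg (by omega), show (2 * j + 2) / 2 - 1 = j by omega]
  have hcases : ∀ n, n = 0 ∨ (∃ j, n = 2 * j + 1) ∨ ∃ j, n = 2 * j + 2 := fun n => by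
    rcases Nat.eq_zero_or_pos n with h | h
    · exact Or.inl h
    · rcases Nat.mod_two_eq_zero_or_one n with h' | h'
      · exact Or.inr (Or.inr ⟨n / 2 - 1, by omega⟩)
      · exact Or.inr (Or.inl ⟨n / 2, by omega⟩)
  refine exists_generator_of_code (D := C) hT hMT (fun x => by have := hM x; omega) hB hdisc hrec
    ?_ ?_ ?_ ?_
  · intro n
    obtain rfl | ⟨j, rfl⟩ | ⟨j, rfl⟩ := hcases n
    · exact hB.inter hY
    · rw [hC1]; exact hD j
    · rw [hC2]; exact hD' j
  · intro n
    obtain rfl | ⟨j, rfl⟩ | ⟨j, rfl⟩ := hcases n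
    · exact inter_subset_left
    · rw [hC1]; exact (hDB j).trans inter_subset_left
    · rw [hC2]; exact (hDB' j).trans inter_subset_left
  · intro n b hb
    obtain rfl | ⟨j, rfl⟩ | ⟨j, rfl⟩ := hcases n
    · have := hM b; omega
    · rw [hC1] at hb; have := hDM j b hb; omega
    · rw [hC2] at hb; have := hDM' j b hb; omega
  · intro m hTm hBm hCm E hE
    have hYm : MeasurableSet[m] Y := measurableSet_of_inter_recurrent hTm hYT hrec (hCm 0)
    have h1 := hcode m hTm hBm hYm (fun j => hC1 j ▸ hCm _) E hE
    have h2 := hcode' m hTm hBm hYm.compl (fun j => hC2 j ▸ hCm _) E hE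
    have : E ∩ B = (E ∩ (B ∩ Y)) ∪ (E ∩ (B ∩ Yᶜ)) := by
      rw [← inter_union_distrib_left, inter_union_compl]
    rw [this]
    exact h1.union h2

end Combination

end TwoSetGenerator

open MeasureTheory

open TwoSetGenerator in
/-- **Main theorem.** Every Borel system `(X,𝓑,T)` without invariant Borel probability
measures admits a two-set generator: there is a Borel set `A` such that the σ-algebra
generated by the family `{T^n A : n ∈ ℤ}` equals the Borel σ-algebra `𝓑`. -/
theorem two_set_generator_of_no_invariant_measure {X : Type*} [MeasurableSpace X]
    [StandardBorelSpace X] (T : Equiv.Perm X) (hT : Measurable T) (hTinv : Measurable T.symm)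
    (hno : ¬ ∃ μ : Measure X, IsProbabilityMeasure μ ∧
      ∀ E : Set X, MeasurableSet E → μ (⇑T ⁻¹' E) = μ E) :
    ∃ A : Set X, MeasurableSet A ∧
      MeasurableSpace.generateFrom {s : Set X | ∃ n : ℤ, s = ⇑(T ^ n) '' A}
        = ‹MeasurableSpace X› := by
  have hTa : IsAuto T ‹MeasurableSpace X› := ⟨hT, hTinv⟩
  have hap := aperiodic_of_no_invariant_measure hno
  obtain ⟨c₀, hc₀, hnontight⟩ := exists_nontight hTa hno
  obtain ⟨Y, hY, hYT, κ, hκ, hκT, hκ0, ⟨g, hg, hg1, hosc⟩, c, hc, d, hd, hdT, hlim⟩ :=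
    exists_divergent_or_deficient hT hc₀ hnontight
  let M : X → ℕ := fun x => 200 * κ x
  have hM : Measurable M := hκ.const_mul 200
  have hMT : ∀ x, M (T x) = M x := fun x => by simp only [M, hκT]
  have hMpos : ∀ x, 0 < M x := fun x => Nat.mul_pos (by norm_num) (hκ0 x)
  obtain ⟨B, -, hB, hdisc, hnear⟩ := exists_marker hTa hap hM hMT hMpos MeasurableSet.univ
  have hnear : ∀ x, ∃ i : ℤ, |i| < M x ∧ (T ^ i) x ∈ B := fun x => hnear x trivial
  have hYT' : ∀ x, T x ∈ Yᶜ ↔ x ∈ Yᶜ := fun x => not_congr (hYT x)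
  obtain ⟨D, hD, hDB, hDM, hcode⟩ := exists_code_of_divergent hTa hM hMT hκ hκT hκ0
    (fun x => le_rfl) hB hdisc hnear hY hYT hg hg1 hosc
  obtain ⟨D', hD', hDB', hDM', hcode'⟩ := exists_code_of_deficient hTa hap hM hMT hκ0
    (fun x => le_rfl) hB hdisc hnear hY.compl hYT' hc hd hdT hlim
  exact exists_generator_of_codes hTa hMT (fun x => by have := hκ0 x; simp only [M]; omega) hB hdisc
    (fun x => (hnear x).imp fun i hi => hi.2) hY hYT hD hDB hDM hcode hD' hDB' hDM' hcode'
end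

section
/- Let (X, 𝓑, T) be a Borel system and A ∈ 𝓑. Then the restriction of T to the T-invariant Borel set nul(A) admits a 4-set generator. -/
open Filter
open scoped Classical

/-- The frequency of visits of the first `N` points of the forward orbit of `x` to `A`:
`S_N(x,A) = (1/N) · #{0 ≤ i < N : T^i x ∈ A}`. -/
noncomputable def visitFreq {X : Type*} (T : Equiv.Perm X) (A : Set X) (x : X) (N : ℕ) : ℝ :=
  (∑ i ∈ Finset.range N, if (T ^ i) x ∈ A then (1 : ℝ) else 0) / N

/-- The set of `A`-null points: `x ∈ ⋃_{n∈ℤ} T^n A` and `s(x,A) = 0`. -/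
def nulSet {X : Type*} (T : Equiv.Perm X) (A : Set X) : Set X :=
  {x | (∃ n : ℤ, x ∈ ⇑(T ^ n) '' A) ∧ Tendsto (visitFreq T A x) atTop (nhds 0)}

/-- `Y` admits a `k`-set generator for (the restriction of) `T`: there is a partition of `Y`
into `k` Borel sets `A_1, …, A_k` such that the σ-algebra on `Y` generated by all the sets
`T^n A_i` equals the trace σ-algebra. -/
def IsGeneratorOn {X : Type*} [MeasurableSpace X] (T : Equiv.Perm X) (Y : Set X) (k : ℕ) :
    Prop :=
  ∃ A : Fin k → Set X,
    (∀ i, MeasurableSet (A i)) ∧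
    (∀ i, A i ⊆ Y) ∧
    (Pairwise fun i j => Disjoint (A i) (A j)) ∧
    (⋃ i, A i) = Y ∧
    MeasurableSpace.generateFrom
        {s : Set Y | ∃ (n : ℤ) (i : Fin k), s = Subtype.val ⁻¹' (⇑(T ^ n) '' A i)}
      = (inferInstance : MeasurableSpace Y)

/-! ### Visit patterns in `ℤ` -/

namespace VisitPattern

/-- The number of elements of `S` in the interval `[a, b)`. -/
noncomputable def count (S : Set ℤ) (a b : ℤ) : ℕ := {n ∈ Finset.Ico a b | n ∈ S}.card

/-- The translate of `S` by `-s`. -/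
def shift (s : ℤ) (S : Set ℤ) : Set ℤ := {n | n + s ∈ S}

/-- The times from which every forward visit frequency to `E` is less than `1 / (k + 1)`. -/
def sparseTimes (k : ℕ) (E : Set ℤ) : Set ℤ :=
  {t | ∀ s, t < s → ((k + 1) * count E t s : ℤ) < s - t}

/-- The times `a ∈ E` and `b ∈ F` lie in the same block delimited by successive elements of `R`,
and have the same rank in `E` and in `F` respectively, counted from the start of the block. -/
def Matched (E R F : Set ℤ) (a b : ℤ) : Prop :=
  ∃ t, t ∈ R ∧ t ≤ a ∧ t ≤ b ∧ (∀ s, s ∈ R → t < s → a < s ∧ b < s) ∧ a ∈ E ∧ b ∈ F ∧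
    count E t a = count F t b

/-- The times that remain unused once each element of `E` has been given `k` slots. -/
def free : ℕ → Set ℤ → Set ℤ
  | 0, _ => Set.univ
  | k + 1, E => {b | b ∈ free k E ∧ ¬ ∃ a, Matched E (sparseTimes k E) (free k E) a b}

/-- `a` is the first `k`-sparse time, for the least `k` for which there is a first one. -/
def IsOrigin (E : Set ℤ) (a : ℤ) : Prop :=
  ∃ k, IsLeast (sparseTimes k E) a ∧ ∀ j < k, ¬ ∃ b, IsLeast (sparseTimes j E) b

/-- `b` is the slot in which the `k`-th bit of the time `a` is stored. -/
def Slot (k : ℕ) (E : Set ℤ) (a b : ℤ) : Prop :=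
  (IsOrigin E a ∧ b = a + k) ∨
    ((¬ ∃ c, IsOrigin E c) ∧ Matched E (sparseTimes k E) (free k E) a b)

/-- `E` is nonempty with forward density zero. -/
def IsNull (E : Set ℤ) : Prop :=
  E.Nonempty ∧ ∀ (c : ℕ) (t : ℤ), ∃ N : ℤ, ∀ s, N ≤ s → (c * count E t s : ℤ) < s - t

/-! #### Counting -/

lemma count_self (S : Set ℤ) (a : ℤ) : count S a a = 0 := by simp [count]

lemma count_add (S : Set ℤ) {a b c : ℤ} (hab : a ≤ b) (hbc : b ≤ c) :
    count S a c = count S a b + count S b c := by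
  unfold count
  rw [← Finset.card_union_of_disjoint, ← Finset.filter_union, Finset.Ico_union_Ico_eq_Ico hab hbc]
  exact Finset.disjoint_filter_filter (Finset.Ico_disjoint_Ico_consecutive a b c)

lemma count_succ (S : Set ℤ) {a b : ℤ} (hab : a ≤ b) :
    count S a (b + 1) = count S a b + if b ∈ S then 1 else 0 := by
  rw [count_add S hab (by lia)]
  congr 1
  have : Finset.Ico b (b + 1) = {b} := by ext; simp; lia
  rw [count, this, Finset.filter_singleton]
  split_ifs <;> simp

lemma count_lt_count {S : Set ℤ} {t a b : ℤ} (hta : t ≤ a) (ha : a ∈ S) (hab : a < b) :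
    count S t a < count S t b := by
  rw [count_add S (show t ≤ a + 1 by lia) (show a + 1 ≤ b by lia), count_succ S hta, if_pos ha]
  lia

lemma eq_of_count_eq {S : Set ℤ} {t a b : ℤ} (hta : t ≤ a) (htb : t ≤ b) (ha : a ∈ S)
    (hb : b ∈ S) (h : count S t a = count S t b) : a = b := by
  rcases lt_trichotomy a b with hab | hab | hab
  · exact absurd h (count_lt_count hta ha hab).ne
  · exact hab
  · exact absurd h (count_lt_count htb hb hab).ne'

lemma exists_count_eq {S : Set ℤ} {t b : ℤ} {i : ℕ} (htb : t ≤ b) (hi : i < count S t b) :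
    ∃ c ∈ S, t ≤ c ∧ c < b ∧ count S t c = i := by
  induction b, htb using Int.leInduction with
  | base => simp [count_self] at hi
  | succ b htb ih =>
    by_cases h : i < count S t b
    · obtain ⟨c, hc, htc, hcb, h⟩ := ih h
      exact ⟨c, hc, htc, by lia, h⟩
    · rw [count_succ S htb] at hi
      by_cases hb : b ∈ S
      · rw [if_pos hb] at hi
        exact ⟨b, hb, htb, by lia, by lia⟩
      · rw [if_neg hb] at hi
        lia

lemma count_univ {a b : ℤ} (hab : a ≤ b) : (count Set.univ a b : ℤ) = b - a := by
  simp [count, hab]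

lemma count_le_sub (S : Set ℤ) {a b : ℤ} (hab : a ≤ b) : (count S a b : ℤ) ≤ b - a := by
  have h := Finset.card_filter_le (Finset.Ico a b) (· ∈ S)
  rw [Int.card_Ico] at h
  unfold count
  lia

/-! #### Translation -/

@[simp] lemma mem_shift {s n : ℤ} {S : Set ℤ} : n ∈ shift s S ↔ n + s ∈ S := Iff.rfl

lemma count_shift (s : ℤ) (S : Set ℤ) (a b : ℤ) :
    count (shift s S) a b = count S (a + s) (b + s) := by
  unfold count
  refine Finset.card_bij (fun n _ => n + s) ?_ ?_ ?_
  · simp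
  · simp
  · intro n hn
    exact ⟨n - s, by simp at hn ⊢; grind, by simp⟩

lemma forall_add_iff {p : ℤ → Prop} (s : ℤ) : (∀ n, p (n + s)) ↔ ∀ n, p n :=
  (Equiv.addRight s).forall_congr_left.trans (by simp)

lemma exists_add_iff {p : ℤ → Prop} (s : ℤ) : (∃ n, p (n + s)) ↔ ∃ n, p n :=
  (Equiv.addRight s).exists_congr_left.trans (by simp)

lemma sparseTimes_shift (k : ℕ) (s : ℤ) (E : Set ℤ) :
    sparseTimes k (shift s E) = shift s (sparseTimes k E) := by
  ext t
  simp only [sparseTimes, mem_shift, Set.mem_ofPred_eq, count_shift]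
  rw [← forall_add_iff s
    (p := fun u => t + s < u → ((k + 1) * count E (t + s) u : ℤ) < u - (t + s))]
  simp

lemma matched_shift (s : ℤ) (E R F : Set ℤ) (a b : ℤ) :
    Matched (shift s E) (shift s R) (shift s F) a b ↔ Matched E R F (a + s) (b + s) := by
  unfold Matched
  rw [← exists_add_iff s (p := fun t => t ∈ R ∧ t ≤ a + s ∧ t ≤ b + s ∧ _)]
  refine exists_congr fun t => ?_
  rw [← forall_add_iff s (p := fun u => u ∈ R → t + s < u → a + s < u ∧ b + s < u)]
  simp [count_shift]

lemma free_shift (k : ℕ) (s : ℤ) (E : Set ℤ) : free k (shift s E) = shift s (free k E) := by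
  induction k with
  | zero => rfl
  | succ k ih =>
    ext b
    simp only [free, ih, sparseTimes_shift, matched_shift, Set.mem_ofPred_eq, mem_shift]
    rw [exists_add_iff s (p := fun a => Matched E (sparseTimes k E) (free k E) a (b + s))]

lemma isLeast_shift (s : ℤ) (S : Set ℤ) (a : ℤ) : IsLeast (shift s S) a ↔ IsLeast S (a + s) := by
  simp only [IsLeast, mem_lowerBounds, mem_shift]
  rw [← forall_add_iff s (p := fun x => x ∈ S → a + s ≤ x)]
  simp

lemma isOrigin_shift (s : ℤ) (E : Set ℤ) (a : ℤ) :
    IsOrigin (shift s E) a ↔ IsOrigin E (a + s) := by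
  simp only [IsOrigin, sparseTimes_shift, isLeast_shift,
    fun j => exists_add_iff s (p := fun b => IsLeast (sparseTimes j E) b)]

lemma slot_shift (k : ℕ) (s : ℤ) (E : Set ℤ) (a b : ℤ) :
    Slot k (shift s E) a b ↔ Slot k E (a + s) (b + s) := by
  simp only [Slot, isOrigin_shift, sparseTimes_shift, free_shift, matched_shift,
    exists_add_iff s (p := fun c => IsOrigin E c)]
  grind

lemma isNull_shift {s : ℤ} {E : Set ℤ} (h : IsNull E) : IsNull (shift s E) := by
  refine ⟨?_, fun c t => ?_⟩
  · obtain ⟨n, hn⟩ := h.1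
    exact ⟨n - s, by simpa using hn⟩
  · obtain ⟨N, hN⟩ := h.2 c (t + s)
    refine ⟨N - s, fun u hu => ?_⟩
    have := hN (u + s) (by lia)
    rw [count_shift]
    lia

/-! #### Slots -/

lemma Matched.left_unique {E R F : Set ℤ} {a a' b : ℤ} (h : Matched E R F a b)
    (h' : Matched E R F a' b) : a = a' := by
  obtain ⟨t, htR, hta, htb, ht, ha, -, hc⟩ := h
  obtain ⟨t', htR', hta', htb', ht', ha', -, hc'⟩ := h'
  obtain rfl : t = t' := by grind
  exact eq_of_count_eq hta hta' ha ha' (hc.trans hc'.symm)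

lemma Matched.right_unique {E R F : Set ℤ} {a b b' : ℤ} (h : Matched E R F a b)
    (h' : Matched E R F a b') : b = b' := by
  obtain ⟨t, htR, hta, htb, ht, -, hb, hc⟩ := h
  obtain ⟨t', htR', hta', htb', ht', -, hb', hc'⟩ := h'
  obtain rfl : t = t' := by grind
  exact eq_of_count_eq htb htb' hb hb' (hc.symm.trans hc')

lemma sparseTimes_antitone (E : Set ℤ) : Antitone fun k => sparseTimes k E := by
  intro j k hjk t ht s hs
  refine lt_of_le_of_lt ?_ (ht s hs)
  gcongr

lemma free_antitone (E : Set ℤ) : Antitone fun k => free k E :=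
  antitone_nat_of_succ_le fun _ _ h => h.1

lemma count_free_le {k : ℕ} {E : Set ℤ} {t u : ℤ} (ht : t ∈ sparseTimes k E)
    (hu : u ∈ sparseTimes k E) :
    count (free k E) t u ≤ count (free (k + 1) E) t u + count E t u := by
  have hsub : {n ∈ Finset.Ico t u | n ∈ free k E} ⊆ {n ∈ Finset.Ico t u | n ∈ free (k + 1) E} ∪
      {b ∈ Finset.Ico t u | ∃ a, Matched E (sparseTimes k E) (free k E) a b} := by
    intro n hn
    obtain ⟨hI, hF⟩ := Finset.mem_filter.1 hn
    by_cases h : ∃ a, Matched E (sparseTimes k E) (free k E) a n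
    · exact Finset.mem_union_right _ (Finset.mem_filter.2 ⟨hI, h⟩)
    · exact Finset.mem_union_left _ (Finset.mem_filter.2 ⟨hI, hF, h⟩)
  refine (Finset.card_le_card hsub).trans ((Finset.card_union_le _ _).trans ?_)
  refine Nat.add_le_add_left ?_ _
  refine Finset.card_le_card_of_forall_subsingleton
    (fun b a => Matched E (sparseTimes k E) (free k E) a b) ?_ ?_
  · intro b hb
    simp only [Finset.mem_filter, Finset.mem_Ico] at hb
    obtain ⟨⟨htb, hbu⟩, a, h⟩ := hb
    refine ⟨a, ?_, h⟩
    obtain ⟨r, hr, hra, hrb, hmax, ha, -, -⟩ := h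
    simp only [Finset.mem_filter, Finset.mem_Ico]
    grind
  · rintro a - b ⟨-, hb⟩ b' ⟨-, hb'⟩
    exact hb.right_unique hb'

lemma sub_le_count_free {k : ℕ} {E : Set ℤ} {t u : ℤ} (htu : t ≤ u) (ht : t ∈ sparseTimes k E)
    (hu : u ∈ sparseTimes k E) {j : ℕ} (hj : j ≤ k) :
    u - t ≤ (count (free j E) t u + j * count E t u : ℤ) := by
  induction j with
  | zero => simp [free, count_univ htu]
  | succ j ih =>
    have hjk : j ≤ k := by lia
    have h := count_free_le (sparseTimes_antitone E hjk ht) (sparseTimes_antitone E hjk hu)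
    have := ih hjk
    push_cast
    zify at h
    linarith

lemma count_lt_count_free {k : ℕ} {E : Set ℤ} {t u : ℤ} (htu : t < u) (ht : t ∈ sparseTimes k E)
    (hu : u ∈ sparseTimes k E) : count E t u < count (free k E) t u := by
  have h := sub_le_count_free htu.le ht hu le_rfl
  have h' := ht u htu
  zify
  linarith

lemma IsNull.exists_ge_mem_sparseTimes {E : Set ℤ} (hE : IsNull E) (k : ℕ) (t : ℤ) :
    ∃ s ∈ sparseTimes k E, t ≤ s := by
  obtain ⟨N, hN⟩ := hE.2 (k + 1) t
  obtain ⟨u, ⟨htu, hu⟩, hmax⟩ := Int.exists_greatest_of_bdd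
    (P := fun s => t ≤ s ∧ s - t ≤ ((k + 1 : ℕ) * count E t s : ℤ))
    ⟨N, fun z hz => by by_contra! h; have := hN z h.le; lia⟩ ⟨t, by simp [count_self]⟩
  refine ⟨u, fun s hs => ?_, htu⟩
  have h : ¬ (s - t ≤ ((k + 1 : ℕ) * count E t s : ℤ)) :=
    fun h => absurd (hmax s ⟨by lia, h⟩) (by lia)
  rw [count_add E htu hs.le] at h
  push_cast at h hu
  linarith

lemma exists_isOrigin {E : Set ℤ} {k : ℕ} {a : ℤ} (h : IsLeast (sparseTimes k E) a) :
    ∃ c, IsOrigin E c := by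
  have hex : ∃ k a, IsLeast (sparseTimes k E) a := ⟨k, a, h⟩
  obtain ⟨c, hc⟩ := Nat.find_spec hex
  exact ⟨c, _, hc, fun j hj => Nat.find_min hex hj⟩

lemma IsOrigin.unique {E : Set ℤ} {a b : ℤ} (ha : IsOrigin E a) (hb : IsOrigin E b) : a = b := by
  obtain ⟨j, hj, hj'⟩ := ha
  obtain ⟨k, hk, hk'⟩ := hb
  rcases lt_trichotomy j k with h | rfl | h
  · exact absurd ⟨a, hj⟩ (hk' j h)
  · exact hj.unique hk
  · exact absurd ⟨b, hk⟩ (hj' k h)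

lemma IsNull.exists_matched {E : Set ℤ} (hE : IsNull E) (h : ¬ ∃ c, IsOrigin E c) {a : ℤ}
    (ha : a ∈ E) (k : ℕ) : ∃ b, Matched E (sparseTimes k E) (free k E) a b := by
  have hbelow : ∃ t ∈ sparseTimes k E, t ≤ a := by
    by_contra! hlt
    obtain ⟨s, hs, -⟩ := hE.exists_ge_mem_sparseTimes k a
    obtain ⟨l, hl, hmin⟩ := Int.exists_least_of_bdd (P := (· ∈ sparseTimes k E))
      ⟨a, fun z hz => (hlt z hz).le⟩ ⟨s, hs⟩
    exact h (exists_isOrigin ⟨hl, hmin⟩)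
  obtain ⟨t, ⟨ht, hta⟩, hmax⟩ := Int.exists_greatest_of_bdd
    (P := fun s => s ∈ sparseTimes k E ∧ s ≤ a) ⟨a, fun z hz => hz.2⟩ hbelow
  obtain ⟨s, hs, has⟩ := hE.exists_ge_mem_sparseTimes k (a + 1)
  obtain ⟨u, ⟨hu, hau⟩, hmin⟩ := Int.exists_least_of_bdd
    (P := fun s => s ∈ sparseTimes k E ∧ a < s) ⟨a, fun z hz => hz.2.le⟩ ⟨s, hs, by lia⟩
  obtain ⟨b, hb, htb, hbu, hcount⟩ := exists_count_eq (show t ≤ u by lia)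
    ((count_lt_count hta ha hau).trans (count_lt_count_free (by lia) ht hu))
  exact ⟨b, t, ht, hta, htb, by grind, ha, hb, hcount.symm⟩

lemma IsNull.exists_slot {E : Set ℤ} (hE : IsNull E) : ∃ a, ∀ k, ∃ b, Slot k E a b := by
  by_cases h : ∃ c, IsOrigin E c
  · obtain ⟨c, hc⟩ := h
    exact ⟨c, fun k => ⟨c + k, Or.inl ⟨hc, rfl⟩⟩⟩
  · obtain ⟨a, ha⟩ := hE.1
    refine ⟨a, fun k => ?_⟩
    obtain ⟨b, hb⟩ := hE.exists_matched h ha k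
    exact ⟨b, Or.inr ⟨h, hb⟩⟩

lemma Slot.unique {E : Set ℤ} {j k : ℕ} {a a' b : ℤ} (h : Slot j E a b) (h' : Slot k E a' b) :
    j = k ∧ a = a' := by
  have hle : ∀ {j k : ℕ} {a a' : ℤ}, Matched E (sparseTimes j E) (free j E) a b →
      Matched E (sparseTimes k E) (free k E) a' b → ¬ j < k := by
    rintro j k a a' h ⟨-, -, -, -, -, -, hb, -⟩ hjk
    exact (free_antitone E (Nat.succ_le_of_lt hjk) hb).2 ⟨a, h⟩
  rcases h with ⟨ho, hb⟩ | ⟨hno, hm⟩ <;> rcases h' with ⟨ho', hb'⟩ | ⟨hno', hm'⟩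
  · obtain rfl := ho.unique ho'
    exact ⟨by lia, rfl⟩
  · exact absurd ⟨a, ho⟩ hno'
  · exact absurd ⟨a', ho'⟩ hno
  · obtain rfl : j = k := le_antisymm (not_lt.1 (hle hm' hm)) (not_lt.1 (hle hm hm'))
    exact ⟨rfl, hm.left_unique hm'⟩

/-! #### Measurability -/

section Measurability

variable {X : Type*} [MeasurableSpace X] {E R F : X → Set ℤ}

lemma measurable_count (hE : ∀ n, Measurable fun x => n ∈ E x) (a b : ℤ) :
    Measurable fun x => count (E x) a b := by
  simp only [count, Finset.card_filter]
  exact Finset.measurable_sum _ fun n _ =>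
    Measurable.ite (hE n).setOf measurable_const measurable_const

lemma measurable_mem_sparseTimes (hE : ∀ n, Measurable fun x => n ∈ E x) (k : ℕ) (t : ℤ) :
    Measurable fun x => t ∈ sparseTimes k (E x) := by
  refine Measurable.forall fun s => measurable_const.imp ?_
  exact (measurable_from_top (f := fun c : ℕ => ((k + 1) * c : ℤ) < s - t)).comp
    (measurable_count hE t s)

lemma measurable_matched (hE : ∀ n, Measurable fun x => n ∈ E x)
    (hR : ∀ n, Measurable fun x => n ∈ R x) (hF : ∀ n, Measurable fun x => n ∈ F x) (a b : ℤ) :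
    Measurable fun x => Matched (E x) (R x) (F x) a b := by
  refine Measurable.exists fun t => (hR t).and <| measurable_const.and <| measurable_const.and <|
    (Measurable.forall fun s => (hR s).imp measurable_const).and <| (hE a).and <| (hF b).and ?_
  exact measurableSet_setOfPred.1
    (measurableSet_eq_fun (measurable_count hE t a) (measurable_count hF t b))

lemma measurable_mem_free (hE : ∀ n, Measurable fun x => n ∈ E x) (k : ℕ) (b : ℤ) :
    Measurable fun x => b ∈ free k (E x) := by
  induction k generalizing b with
  | zero => exact measurable_const
  | succ k ih =>
    exact (ih b).and (Measurable.exists fun a =>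
      measurable_matched hE (measurable_mem_sparseTimes hE k) ih a b).not

lemma measurable_isLeast (hR : ∀ n, Measurable fun x => n ∈ R x) (a : ℤ) :
    Measurable fun x => IsLeast (R x) a :=
  (hR a).and (Measurable.forall fun b => (hR b).imp measurable_const)

lemma measurable_isOrigin (hE : ∀ n, Measurable fun x => n ∈ E x) (a : ℤ) :
    Measurable fun x => IsOrigin (E x) a :=
  Measurable.exists fun k => (measurable_isLeast (measurable_mem_sparseTimes hE k) a).and <|
    Measurable.forall fun j => measurable_const.imp <| Measurable.not <|
      Measurable.exists fun b => measurable_isLeast (measurable_mem_sparseTimes hE j) b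

lemma measurable_slot (hE : ∀ n, Measurable fun x => n ∈ E x) (k : ℕ) (a b : ℤ) :
    Measurable fun x => Slot k (E x) a b :=
  ((measurable_isOrigin hE a).and measurable_const).or <|
    (Measurable.exists fun c => measurable_isOrigin hE c).not.and <|
      measurable_matched hE (measurable_mem_sparseTimes hE k) (measurable_mem_free hE k) a b

lemma measurable_isNull (hE : ∀ n, Measurable fun x => n ∈ E x) :
    Measurable fun x => IsNull (E x) := by
  refine (Measurable.exists hE).and <| Measurable.forall fun c => Measurable.forall fun t =>
    Measurable.exists fun N => Measurable.forall fun s => measurable_const.imp ?_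
  exact (measurable_from_top (f := fun m : ℕ => (c * m : ℤ) < s - t)).comp
    (measurable_count hE t s)

end Measurability

end VisitPattern

/-! ### Visit patterns of orbits -/

open VisitPattern

/-- The times at which the orbit of `x` visits `A`. -/
def visitTimes {X : Type*} (T : Equiv.Perm X) (A : Set X) (x : X) : Set ℤ := {n | (T ^ n) x ∈ A}

lemma visitTimes_zpow {X : Type*} (T : Equiv.Perm X) (A : Set X) (x : X) (s : ℤ) :
    visitTimes T A ((T ^ s) x) = shift s (visitTimes T A x) := by
  ext n
  simp [visitTimes, zpow_add]

lemma visitFreq_eq {X : Type*} (T : Equiv.Perm X) (A : Set X) (x : X) (N : ℕ) :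
    visitFreq T A x N = count (visitTimes T A x) 0 N / N := by
  unfold visitFreq
  congr 1
  induction N with
  | zero => simp [count_self]
  | succ N ih =>
    rw [Finset.sum_range_succ, ih, Nat.cast_succ, count_succ _ (Int.natCast_nonneg N)]
    simp [visitTimes]

lemma isNull_of_tendsto {E : Set ℤ} (hne : E.Nonempty)
    (h : Tendsto (fun N : ℕ => (count E 0 N / N : ℝ)) atTop (nhds 0)) : IsNull E := by
  refine ⟨hne, fun c t => ?_⟩
  obtain ⟨M, hM⟩ := eventually_atTop.1 (h.eventually_lt_const (u := (1 / (2 * (c + 1)) : ℝ))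
    (by positivity))
  refine ⟨M + 2 * (c + 1) * |t| + 1, fun s hs => ?_⟩
  have hpos : 0 ≤ (c * |t| : ℤ) := by positivity
  have habs := le_abs_self t
  have hneg := neg_abs_le t
  lift s to ℕ using by nlinarith
  have hs0 : (0 : ℝ) < s := by
    have : (0 : ℤ) < s := by nlinarith
    exact_mod_cast this
  have hlt := hM s (by zify; nlinarith)
  rw [div_lt_div_iff₀ hs0 (by positivity)] at hlt
  have hlt' : (count E 0 s * (2 * (c + 1)) : ℤ) < s := by
    have : (count E 0 s * (2 * (c + 1)) : ℝ) < s := by linarith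
    exact_mod_cast this
  have hcount : (count E t s : ℤ) ≤ count E 0 s + |t| := by
    rcases le_total t 0 with ht | ht
    · rw [count_add E ht (Int.natCast_nonneg s)]
      have := count_le_sub E ht
      push_cast
      lia
    · rw [count_add E ht (show t ≤ s by nlinarith)]
      push_cast
      lia
  have hmul := mul_le_mul_of_nonneg_left hcount (Int.natCast_nonneg c)
  nlinarith

lemma tendsto_of_isNull {E : Set ℤ} (h : IsNull E) :
    Tendsto (fun N : ℕ => (count E 0 N / N : ℝ)) atTop (nhds 0) := by
  rw [Metric.tendsto_atTop]
  intro ε hε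
  obtain ⟨c, hc⟩ := exists_nat_gt ε⁻¹
  obtain ⟨M, hM⟩ := h.2 c 0
  refine ⟨M.toNat + 1, fun N hN => ?_⟩
  have hlt := hM N (by lia)
  have hN0 : (0 : ℝ) < N := by exact_mod_cast (show 0 < N by lia)
  have hlt' : (c * count E 0 N : ℝ) < N := by
    rw [sub_zero] at hlt
    exact_mod_cast hlt
  rw [Real.dist_eq, sub_zero, abs_of_nonneg (by positivity), div_lt_iff₀ hN0]
  have hone : 1 < ε * c := by
    rwa [inv_lt_iff_one_lt_mul₀ hε, mul_comm] at hc
  nlinarith [Nat.cast_nonneg (α := ℝ) (count E 0 N)]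

lemma mem_nulSet_iff {X : Type*} (T : Equiv.Perm X) (A : Set X) (x : X) :
    x ∈ nulSet T A ↔ IsNull (visitTimes T A x) := by
  have hne : (∃ n : ℤ, x ∈ ⇑(T ^ n) '' A) ↔ (visitTimes T A x).Nonempty := by
    constructor
    · rintro ⟨n, y, hy, rfl⟩
      exact ⟨-n, by simpa [visitTimes] using hy⟩
    · rintro ⟨n, hn⟩
      exact ⟨-n, _, hn, by simp⟩
  have hfreq : visitFreq T A x = fun N : ℕ => (count (visitTimes T A x) 0 N / N : ℝ) :=
    funext (visitFreq_eq T A x)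
  rw [nulSet, Set.mem_ofPred_eq, hne, hfreq]
  exact ⟨fun h => isNull_of_tendsto h.1 h.2, fun h => ⟨h.1, tendsto_of_isNull h⟩⟩

lemma zpow_mem_nulSet {X : Type*} {T : Equiv.Perm X} {A : Set X} {x : X} (hx : x ∈ nulSet T A)
    (n : ℤ) : (T ^ n) x ∈ nulSet T A := by
  rw [mem_nulSet_iff] at hx ⊢
  rw [visitTimes_zpow]
  exact isNull_shift hx

lemma measurable_zpow_perm {X : Type*} [MeasurableSpace X] {T : Equiv.Perm X} (hT : Measurable T)
    (hTinv : Measurable T.symm) (n : ℤ) : Measurable ⇑(T ^ n) := by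
  have hpow : ∀ {S : Equiv.Perm X}, Measurable S → ∀ n : ℕ, Measurable ⇑(S ^ n) := by
    intro S hS n
    rw [Equiv.Perm.coe_pow]
    exact hS.iterate n
  cases n with
  | ofNat n => exact hpow hT n
  | negSucc n =>
    rw [zpow_negSucc, ← inv_pow]
    exact hpow (S := T⁻¹) hTinv (n + 1)

/-! ### The data set -/

/-- The points whose stored bit is `true`, when each source time `a` of the orbit of `x` stores the
bits of `f (T ^ a x)` in its slots. -/
def dataSet {X : Type*} (T : Equiv.Perm X) (A : Set X) (f : X → ℕ → Bool) : Set X :=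
  {z | ∃ (k : ℕ) (n : ℤ), Slot k (visitTimes T A z) n 0 ∧ f ((T ^ n) z) k = true}

lemma zpow_mem_dataSet_iff {X : Type*} {T : Equiv.Perm X} {A : Set X} {f : X → ℕ → Bool} {x : X}
    {k : ℕ} {a b : ℤ} (h : Slot k (visitTimes T A x) a b) :
    (T ^ b) x ∈ dataSet T A f ↔ f ((T ^ a) x) k = true := by
  simp only [dataSet, Set.mem_ofPred_eq, visitTimes_zpow, slot_shift, zero_add]
  constructor
  · rintro ⟨j, n, hs, hf⟩
    obtain ⟨rfl, rfl⟩ := hs.unique h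
    simpa [zpow_add] using hf
  · intro hf
    refine ⟨k, a - b, by simpa using h, ?_⟩
    rwa [← Equiv.Perm.mul_apply, ← zpow_add, sub_add_cancel]

lemma eq_of_visits_eq {X : Type*} {T : Equiv.Perm X} {A : Set X} {f : X → ℕ → Bool}
    (hf : Function.Injective f) {x y : X} (hx : x ∈ nulSet T A)
    (hA : ∀ n : ℤ, (T ^ n) x ∈ A ↔ (T ^ n) y ∈ A)
    (hD : ∀ n : ℤ, (T ^ n) x ∈ dataSet T A f ↔ (T ^ n) y ∈ dataSet T A f) : x = y := by
  have hvisit : visitTimes T A x = visitTimes T A y := Set.ext hA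
  obtain ⟨a, ha⟩ := ((mem_nulSet_iff T A x).1 hx).exists_slot
  refine (T ^ a).injective (hf (funext fun k => Bool.eq_iff_iff.2 ?_))
  obtain ⟨b, hb⟩ := ha k
  rw [← zpow_mem_dataSet_iff hb, ← zpow_mem_dataSet_iff (hvisit ▸ hb)]
  exact hD b

lemma generateFrom_range_eq_of_separating {Y ι : Type*} [m : MeasurableSpace Y]
    [StandardBorelSpace Y] [Countable ι] {s : ι → Set Y} (hs : ∀ i, MeasurableSet (s i))
    (hsep : ∀ x y, (∀ i, x ∈ s i ↔ y ∈ s i) → x = y) :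
    MeasurableSpace.generateFrom (Set.range s) = m := by
  refine le_antisymm (MeasurableSpace.generateFrom_le (by rintro _ ⟨i, rfl⟩; exact hs i)) ?_
  let g : Y → ι → Prop := fun x i => x ∈ s i
  have hg : Measurable g := measurable_pi_lambda g fun i => measurable_mem.2 (hs i)
  have hinj : Function.Injective g := fun x y h =>
    hsep x y fun i => iff_of_eq (congrFun h i)
  rw [← (hg.measurableEmbedding hinj).comap_eq, ← measurable_iff_comap_le]
  exact @measurable_pi_lambda _ _ _ (MeasurableSpace.generateFrom (Set.range s)) _ g fun i =>
    (@measurable_mem _ (s i) (MeasurableSpace.generateFrom (Set.range s))).2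
      (MeasurableSpace.measurableSet_generateFrom ⟨i, rfl⟩)

/-- The color of a point records its membership in each of two sets. -/
noncomputable def pairColor {X : Type*} (A D : Set X) (x : X) : Fin 4 :=
  if x ∈ A then if x ∈ D then 3 else 2 else if x ∈ D then 1 else 0

lemma pairColor_eq_iff {X : Type*} {A D : Set X} {x y : X} :
    pairColor A D x = pairColor A D y ↔ (x ∈ A ↔ y ∈ A) ∧ (x ∈ D ↔ y ∈ D) := by
  unfold pairColor
  split_ifs <;> simp_all

lemma measurable_pairColor {X : Type*} [MeasurableSpace X] {A D : Set X} (hA : MeasurableSet A)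
    (hD : MeasurableSet D) : Measurable (pairColor A D) :=
  Measurable.ite hA (Measurable.ite hD measurable_const measurable_const)
    (Measurable.ite hD measurable_const measurable_const)

/-- **Generator theorem for null points.** If `(X,𝓑,T)` is a Borel system and `A ∈ 𝓑`, then the
restriction of `T` to the `T`-invariant Borel set `nul(A)` admits a 4-set generator. -/
theorem nul_has_four_set_generator {X : Type*} [MeasurableSpace X] [StandardBorelSpace X]
    (T : Equiv.Perm X) (hT : Measurable T) (hTinv : Measurable T.symm)
    (A : Set X) (hA : MeasurableSet A) :
    IsGeneratorOn T (nulSet T A) 4 := by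
  have hpow := measurable_zpow_perm hT hTinv
  have hvisit : ∀ n, Measurable fun x => n ∈ visitTimes T A x :=
    fun n => measurable_mem.2 (hpow n hA)
  have hY : MeasurableSet (nulSet T A) := by
    simpa only [← mem_nulSet_iff, Set.ofPred_mem_eq] using (measurable_isNull hvisit).setOf
  obtain ⟨f, hf, hinj⟩ := MeasurableSpace.measurable_injection_nat_bool_of_countablySeparated X
  have hD : MeasurableSet (dataSet T A f) :=
    (Measurable.exists fun k => Measurable.exists fun n => (measurable_slot hvisit k n 0).and
      (measurable_mem.2 (((measurable_pi_apply k).comp (hf.comp (hpow n)))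
        (measurableSet_singleton true)))).setOf
  have hcolor := measurable_pairColor hA hD
  let P : Fin 4 → Set X := fun i => nulSet T A ∩ pairColor A (dataSet T A f) ⁻¹' {i}
  have hP : ∀ i, MeasurableSet (P i) := fun i => hY.inter (hcolor (measurableSet_singleton i))
  refine ⟨P, hP, fun i => Set.inter_subset_left, ?_, ?_, ?_⟩
  · intro i j hij
    exact Set.disjoint_left.2 fun x hi hj => hij (hi.2.symm.trans hj.2)
  · ext x
    simp [P]
  have hmem : ∀ (n : ℤ) (i : Fin 4) (x : X), x ∈ ⇑(T ^ n) '' P i ↔ (T ^ (-n)) x ∈ P i := by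
    intro n i x
    rw [Equiv.image_eq_preimage_symm, zpow_neg]
    rfl
  have : StandardBorelSpace (nulSet T A) := hY.standardBorel
  let s : ℤ × Fin 4 → Set (nulSet T A) := fun p => Subtype.val ⁻¹' (⇑(T ^ p.1) '' P p.2)
  have hs : ∀ p, MeasurableSet (s p) := by
    intro p
    refine measurable_subtype_coe ?_
    rw [show ⇑(T ^ p.1) '' P p.2 = ⇑(T ^ (-p.1)) ⁻¹' P p.2 from Set.ext (hmem p.1 p.2)]
    exact hpow _ (hP p.2)
  have hsep : ∀ x y, (∀ p, x ∈ s p ↔ y ∈ s p) → x = y := by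
    intro x y hxy
    have hcol : ∀ n : ℤ, pairColor A (dataSet T A f) ((T ^ n) x) =
        pairColor A (dataSet T A f) ((T ^ n) y) := by
      intro n
      have h := hxy (-n, pairColor A (dataSet T A f) ((T ^ n) x))
      simp only [s, Set.mem_preimage, hmem, neg_neg] at h
      exact (h.1 ⟨zpow_mem_nulSet x.2 n, rfl⟩).2.symm
    exact Subtype.ext (eq_of_visits_eq hinj x.2 (fun n => (pairColor_eq_iff.1 (hcol n)).1)
      fun n => (pairColor_eq_iff.1 (hcol n)).2)
  have hrange : {t : Set (nulSet T A) | ∃ (n : ℤ) (i : Fin 4),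
      t = Subtype.val ⁻¹' (⇑(T ^ n) '' P i)} = Set.range s := by
    ext t
    simp [s, eq_comm]
  rw [hrange]
  exact generateFrom_range_eq_of_separating hs hsep
end
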